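/- Let k ≥ 6 be even, set t = ⌊(k-1)/2⌋ = (k-2)/2, and let F be a graph with p(F) ≥ t+1. Then there exist ℓ ∈ {0,1} and N = N(k,F) such that for all n ≥ N, the maximum number of edges in an n-vertex 2-connected graph that is simultaneously 𝓒_{≥k}-free and F-free equals ex(t,𝓗) + t(n - t) + ℓ, where 𝓗 = {F[S] : S is a vertex covering of F}. -/

import Mathlib

open SimpleGraph

section Defs

variable {V α β : Type*}

/-- `G` contains a copy of `F` as a (not necessarily induced) subgraph. -/
def ContainsCopy (F : SimpleGraph α) (G : SimpleGraph β) : Prop :=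
  ∃ f : α → β, Function.Injective f ∧ ∀ ⦃a b⦄, F.Adj a b → G.Adj (f a) (f b)

/-- The number of edges of `G`. -/
noncomputable def edgeCount (G : SimpleGraph V) : ℕ := G.edgeSet.ncard

/-- `G` has a cycle of length at least `k`, i.e. `G` is not `𝓒_{≥k}`-free. -/
def HasCycleGE (G : SimpleGraph V) (k : ℕ) : Prop :=
  ∃ (v : V) (w : G.Walk v v), w.IsCycle ∧ k ≤ w.length

/-- `G` is 2-connected: it has at least 3 vertices, is connected, and stays
connected after deleting any single vertex. -/
def TwoConnected [Fintype V] (G : SimpleGraph V) : Prop :=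
  3 ≤ Fintype.card V ∧ G.Connected ∧ ∀ v : V, (G.induce ({v}ᶜ : Set V)).Connected

/-- `p(F) ≥ s`: for every proper 2-coloring of `F` both color classes have size
at least `s` (vacuously true for nonbipartite `F`, where `p(F) = ∞`). -/
def PGE [Fintype α] (F : SimpleGraph α) (s : ℕ) : Prop :=
  ∀ c : α → Bool, (∀ a b, F.Adj a b → c a ≠ c b) →
    s ≤ {a | c a = true}.ncard ∧ s ≤ {a | c a = false}.ncard

/-- `S` is a vertex covering of `F`: the complement of `S` is independent. -/
def IsVertexCovering (F : SimpleGraph α) (S : Set α) : Prop :=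
  ∀ a b, a ∉ S → b ∉ S → ¬ F.Adj a b

/-- `G` is `𝓗`-free, where `𝓗 = {F[S] : S is a vertex covering of F}`. -/
def CoverFree (F : SimpleGraph α) (G : SimpleGraph β) : Prop :=
  ∀ S : Set α, IsVertexCovering F S → ¬ ContainsCopy (F.induce S) G

/-- The maximum number of edges of an `n`-vertex graph satisfying `P`
(a generic Turán-type extremal number). -/
noncomputable def exMax (n : ℕ) (P : SimpleGraph (Fin n) → Prop) : ℕ :=
  sSup {m | ∃ G : SimpleGraph (Fin n), P G ∧ edgeCount G = m}

/-- The number of edges of `G` with both endpoints in `T`, i.e. `e(G[T])`. -/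
noncomputable def edgesWithin (G : SimpleGraph V) (T : Set V) : ℕ :=
  {e ∈ G.edgeSet | ∀ x ∈ e, x ∈ T}.ncard

/-- The number of edges of `G` with both endpoints outside `T`, i.e. `e(G−T)`. -/
noncomputable def edgesOutside (G : SimpleGraph V) (T : Set V) : ℕ :=
  {e ∈ G.edgeSet | ∀ x ∈ e, x ∉ T}.ncard

/-- The number of edges of `G` with exactly one endpoint in `T`, i.e. `e(G−T, T)`. -/
noncomputable def edgesCross (G : SimpleGraph V) (T : Set V) : ℕ :=
  {e ∈ G.edgeSet | ∃ a b, e = s(a, b) ∧ a ∈ T ∧ b ∉ T}.ncard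

/-- The number of neighbors of `u` lying in `T` (e.g. `d_C(u)` for `T = V(C)`). -/
noncomputable def degOn (G : SimpleGraph V) (T : Set V) (u : V) : ℕ :=
  {x ∈ T | G.Adj u x}.ncard

/-- The join `T ∨ I_b` of a graph `T` on `Fin a` with an independent set of
`b` vertices. -/
def joinIndep (a b : ℕ) (T : SimpleGraph (Fin a)) : SimpleGraph (Fin a ⊕ Fin b) :=
  SimpleGraph.fromRel (fun x y =>
    x.isLeft ≠ y.isLeft ∨ ∃ u v, x = Sum.inl u ∧ y = Sum.inl v ∧ T.Adj u v)

end Defs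

/-- There is a path from `u` to `v` of length `n` with vertex set exactly `S`. -/
def PO {V : Type*} (G : SimpleGraph V) (u v : V) (S : Set V) (n : ℕ) : Prop :=
  ∃ w : G.Walk u v, w.IsPath ∧ w.length = n ∧ {x | x ∈ w.support} = S

section PathBasics
variable {V : Type*} {G : SimpleGraph V}

lemma PO.nil (G : SimpleGraph V) (u : V) : PO G u u {u} 0 :=
  ⟨Walk.nil, by simp, by simp, by ext; simp⟩

lemma PO.left {u v : V} {S : Set V} {n : ℕ} (h : PO G u v S n) : u ∈ S := by
  obtain ⟨w, _, _, rfl⟩ := h; simp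

lemma PO.right {u v : V} {S : Set V} {n : ℕ} (h : PO G u v S n) : v ∈ S := by
  obtain ⟨w, _, _, rfl⟩ := h; simp

lemma PO.rev {u v : V} {S : Set V} {n : ℕ} (h : PO G u v S n) : PO G v u S n := by
  obtain ⟨w, h1, h2, rfl⟩ := h
  exact ⟨w.reverse, h1.reverse, by simpa using h2, by ext; simp⟩

lemma PO.append {u v z : V} {S S' : Set V} {n n' : ℕ} (h : PO G u v S n) (h' : PO G v z S' n')
    (hd : ∀ x ∈ S, x ∈ S' → x = v) : PO G u z (S ∪ S') (n + n') := by
  obtain ⟨w, h1, h2, rfl⟩ := h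
  obtain ⟨w', h1', h2', rfl⟩ := h'
  refine ⟨w.append w', ?_, by simp [h2, h2'], by ext; simp [Walk.mem_support_append_iff]⟩
  rw [Walk.isPath_def, Walk.support_append, List.nodup_append]
  rw [Walk.isPath_def] at h1 h1'
  have hs := w'.cons_tail_support
  rw [← hs, List.nodup_cons] at h1'
  refine ⟨h1, h1'.2, ?_⟩
  intro a ha b hb hab
  subst hab
  have := hd a ha (by simpa using List.mem_of_mem_tail hb)
  subst this
  exact h1'.1 hb

lemma PO.snoc {u v z : V} {S : Set V} {n : ℕ} (h : PO G u v S n) (hz : G.Adj v z) (hzS : z ∉ S) :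
    PO G u z (insert z S) (n + 1) := by
  have : PO G v z {v, z} 1 :=
    ⟨Walk.cons hz Walk.nil, by simp [hz.ne], by simp, by ext; simp⟩
  have h2 := h.append this (by
    intro x hx hx'
    rcases hx' with rfl | rfl
    · rfl
    · exact absurd hx hzS)
  have : S ∪ {v, z} = insert z S := by
    have := h.right
    ext x; simp only [Set.mem_union, Set.mem_insert_iff, Set.mem_singleton_iff]
    constructor
    · rintro (h | rfl | h) <;> simp_all
    · tauto
  rwa [this] at h2

lemma PO.edge {u v : V} (h : G.Adj u v) : PO G u v {u, v} 1 :=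
  ⟨Walk.cons h Walk.nil, by simp [h.ne], by simp, by ext; simp⟩

lemma PO.cut {u v z : V} {S : Set V} {n : ℕ} (h : PO G u v S n) (hz : z ∈ S) :
    ∃ S' n', PO G u z S' n' ∧ S' ⊆ S ∧ (v ∈ S' → z = v) := by
  classical
  obtain ⟨w, h1, h2, rfl⟩ := h
  refine ⟨_, _, ⟨w.takeUntil z hz, h1.takeUntil hz, rfl, rfl⟩, ?_, ?_⟩
  · intro x hx; exact Walk.support_takeUntil_subset_support _ _ hx
  · intro hv
    by_contra hne
    exact Walk.endpoint_notMem_support_takeUntil h1 hz (Ne.symm hne) hv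

lemma PO.ofWalk {u v : V} (w : G.Walk u v) : ∃ S n, PO G u v S n ∧ S ⊆ {x | x ∈ w.support} := by
  classical
  exact ⟨_, _, ⟨w.bypass, w.bypass_isPath, rfl, rfl⟩, fun x hx => w.support_bypass_subset_support hx⟩

lemma PO.ncard {u v : V} {S : Set V} {n : ℕ} (h : PO G u v S n) : S.ncard = n + 1 := by
  classical
  obtain ⟨w, h1, h2, rfl⟩ := h
  have : {x | x ∈ w.support} = (w.support.toFinset : Set V) := by ext; simp
  rw [this, Set.ncard_coe_finset, List.toFinset_card_of_nodup h1.support_nodup]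
  simp [h2]

lemma PO.cycle {u v : V} {S S' : Set V} {n n' k : ℕ} (h : PO G u v S n) (h' : PO G v u S' n')
    (huv : u ≠ v) (hd : ∀ x ∈ S, x ∈ S' → x = u ∨ x = v) (hk : k ≤ n + n') (h3 : 3 ≤ n + n') :
    HasCycleGE G k := by
  obtain ⟨w, h1, h2, rfl⟩ := h
  obtain ⟨w', h1', h2', rfl⟩ := h'
  refine ⟨u, w.append w', ?_, by simp; omega⟩
  cases w with
  | nil => exact absurd rfl huv
  | cons ha q =>
    rw [Walk.cons_append, Walk.cons_isCycle_iff]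
    rw [Walk.cons_isPath_iff] at h1
    have hq : PO G _ _ _ _ := ⟨q, h1.1, rfl, rfl⟩
    have hw' : PO G _ _ _ _ := ⟨w', h1', rfl, rfl⟩
    have key : (q.append w').IsPath := by
      rw [Walk.isPath_def, Walk.support_append, List.nodup_append]
      have hp := h1'.support_nodup
      rw [← w'.cons_tail_support, List.nodup_cons] at hp
      refine ⟨h1.1.support_nodup, hp.2, ?_⟩
      intro a ha' b hb hab
      subst hab
      rcases hd a (by simp [ha']) (List.mem_of_mem_tail hb) with rfl | rfl
      · exact h1.2 ha'
      · exact hp.1 hb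
    refine ⟨key, ?_⟩
    intro he
    have := key.length_eq_one_of_mem_edges (by simpa [Sym2.eq_swap] using he)
    simp at this h2
    omega

lemma two_conn_walk [Fintype V] (h : TwoConnected G) (z x y : V) (hx : x ≠ z) (hy : y ≠ z) :
    ∃ w : G.Walk x y, z ∉ w.support := by
  obtain ⟨w⟩ := (h.2.2 z).preconnected ⟨x, by simpa using hx⟩ ⟨y, by simpa using hy⟩
  let w' : G.Walk x y := w.map (Embedding.induce ({z}ᶜ : Set V)).toHom
  have hw' : w'.support = w.support.map (Embedding.induce ({z}ᶜ : Set V)).toHom :=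
    Walk.support_map _ _
  refine ⟨w', ?_⟩
  rw [hw']
  intro hz
  obtain ⟨a, _, ha⟩ := List.mem_map.1 hz
  exact a.2 ha

end PathBasics

section Fan
variable {V : Type*} {G : SimpleGraph V}

lemma PO.finite {u v : V} {S : Set V} {n : ℕ} (h : PO G u v S n) : S.Finite := by
  apply Set.finite_of_ncard_ne_zero
  rw [h.ncard]; omega

lemma PO.cut_lt {u v z : V} {S : Set V} {n : ℕ} (h : PO G u v S n) (hz : z ∈ S) (hne : z ≠ v) :
    ∃ S' n', PO G u z S' n' ∧ S' ⊆ S ∧ n' < n := by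
  obtain ⟨S', n', h', hS, hv⟩ := h.cut hz
  refine ⟨S', n', h', hS, ?_⟩
  have : S'.ncard < S.ncard := by
    apply Set.ncard_lt_ncard _ h.finite
    refine ⟨hS, fun hh => hne (hv (hh h.right))⟩
  rw [h.ncard, h'.ncard] at this
  omega

/-- Connecting two sets while avoiding a vertex. -/
lemma connPath [Fintype V] (h2 : TwoConnected G) (D B : Set V) (z d b : V) (hd : d ∈ D)
    (hdz : d ≠ z) (hb : b ∈ B) (hbz : b ≠ z) :
    ∃ w ∈ D, ∃ e ∈ B, ∃ S n, PO G w e S n ∧ z ∉ S ∧ (∀ x ∈ S, x ∈ D → x = w) ∧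
      (∀ x ∈ S, x ∈ B → x = e) := by
  classical
  have hex : ∃ n, ∃ w ∈ D, ∃ e ∈ B, ∃ S, PO G w e S n ∧ z ∉ S := by
    obtain ⟨w, hw⟩ := two_conn_walk h2 z d b hdz hbz
    obtain ⟨S, n, h, hS⟩ := PO.ofWalk w
    exact ⟨n, d, hd, b, hb, S, h, fun hz => hw (hS hz)⟩
  obtain ⟨w, hw, e, he, S, hS, hz⟩ := Nat.find_spec hex
  refine ⟨w, hw, e, he, S, _, hS, hz, ?_, ?_⟩
  · intro x hx hxD
    by_contra hne
    obtain ⟨S', n', h', hS', hlt⟩ := hS.rev.cut_lt hx hne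
    exact Nat.find_min hex hlt ⟨x, hxD, e, he, S', h'.rev, fun hh => hz (hS' hh)⟩
  · intro x hx hxB
    by_contra hne
    obtain ⟨S', n', h', hS', hlt⟩ := hS.cut_lt hx hne
    exact Nat.find_min hex hlt ⟨w, hw, x, hxB, S', h', fun hh => hz (hS' hh)⟩

/-- A path from `A` to `B` whose only vertex in `A` is its start and whose only vertex in `B`
is its end. -/
def AB (G : SimpleGraph V) (A B : Set V) (a e : V) (S : Set V) : Prop :=
  (∃ n, PO G a e S n) ∧ a ∈ A ∧ e ∈ B ∧ (∀ x ∈ S, x ∈ A → x = a) ∧ (∀ x ∈ S, x ∈ B → x = e)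

/-- Two disjoint paths from `A` to `B`, one starting at `a` and one ending at `e`. -/
def TP (G : SimpleGraph V) (A B : Set V) (a e : V) : Prop :=
  ∃ a1 a2 e1 e2 S1 S2, AB G A B a1 e1 S1 ∧ AB G A B a2 e2 S2 ∧ (∀ x ∈ S1, x ∉ S2) ∧
    (a1 = a ∨ a2 = a) ∧ e1 = e

lemma TP.mk' {A B : Set V} {a e a1 a2 e1 e2 : V} {S1 S2 : Set V} (h1 : AB G A B a1 e1 S1)
    (h2 : AB G A B a2 e2 S2) (hd : ∀ x ∈ S1, x ∉ S2) (ha : a1 = a ∨ a2 = a)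
    (he : e1 = e ∨ e2 = e) : TP G A B a e := by
  rcases he with he | he
  · exact ⟨a1, a2, e1, e2, S1, S2, h1, h2, hd, ha, he⟩
  · exact ⟨a2, a1, e2, e1, S2, S1, h2, h1, fun x hx hx' => hd x hx' hx, ha.symm, he⟩

lemma TP.step [Fintype V] (h2 : TwoConnected G) {A B B' : Set V} {a e e' : V}
    (h : TP G A B a e) (haA : a ∈ A) (hB : ∀ x, x ∈ B' ↔ x ∈ B ∧ x ≠ e) (hadj : G.Adj e e') (he' : e' ∈ B')
    (heA : e' ∉ A) (hex : ∃ b ∈ B', b ≠ e') : TP G A B' a e' := by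
  obtain ⟨a1, a2, e1, e2, S1, S2, ⟨⟨n1, p1⟩, ha1, he1, hA1, hB1⟩, ⟨⟨n2, p2⟩, ha2, he2, hA2, hB2⟩,
    hd, ha, rfl⟩ := h
  have hne : e' ≠ e1 := ((hB _).1 he').2
  have he'S1 : e' ∉ S1 := fun hh => hne (hB1 _ hh ((hB _).1 he').1)
  have hS1B : ∀ x ∈ S1, x ∉ B' := fun x hx hxB => ((hB _).1 hxB).2 (hB1 x hx ((hB _).1 hxB).1)
  have hS2B : ∀ x ∈ S2, x ∈ B' → x = e2 := fun x hx hxB => hB2 x hx ((hB _).1 hxB).1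
  have he2e1 : e2 ≠ e1 := fun hh => hd e1 p1.right (hh ▸ p2.right)
  have he2' : e2 ∈ B' := (hB _).2 ⟨he2, he2e1⟩
  have q1 : AB G A B' a1 e' (insert e' S1) := by
    refine ⟨⟨_, p1.snoc hadj he'S1⟩, ha1, he', ?_, ?_⟩
    · rintro x (rfl | hx) hxA
      · exact absurd hxA heA
      · exact hA1 x hx hxA
    · rintro x (rfl | hx) hxA
      · rfl
      · exact absurd hxA (hS1B x hx)
  have q2 : AB G A B' a2 e2 S2 := ⟨⟨_, p2⟩, ha2, he2', hA2, hS2B⟩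
  by_cases hc : e2 = e'
  · subst hc
    obtain ⟨b, hb, hbe⟩ := hex
    have hae : a ≠ e2 := fun hh => heA (hh ▸ haA)
    obtain ⟨w, hw, f, hf, S, n, p, hz, hD, hE⟩ :=
      connPath h2 (S1 ∪ S2 ∪ A) B' e2 a b (Or.inr haA) hae hb hbe
    rcases Classical.em (w ∈ S1) with hw1 | hw1
    · obtain ⟨T, k, c, hTS, hT⟩ := p1.cut hw1
      refine TP.mk' (e1 := f) (S1 := T ∪ S) (a1 := a1) (e2 := e2) ⟨⟨_, c.append p ?_⟩, ha1, hf, ?_, ?_⟩ q2 ?_ ha (Or.inr rfl)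
      · exact fun x hx hx' => hD x hx' (Or.inl (Or.inl (hTS hx)))
      · rintro x (hx | hx) hxA
        · exact hA1 x (hTS hx) hxA
        · have := hD x hx (Or.inr hxA)
          subst this
          exact hA1 _ hw1 hxA
      · rintro x (hx | hx) hxA
        · exact absurd hxA (hS1B x (hTS hx))
        · exact hE x hx hxA
      · rintro x (hx | hx) hx2
        · exact hd x (hTS hx) hx2
        · have := hD x hx (Or.inl (Or.inr hx2))
          subst this
          exact hd _ hw1 hx2
    rcases Classical.em (w ∈ S2) with hw2 | hw2
    · obtain ⟨T, k, c, hTS, hT⟩ := p2.cut hw2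
      have hwe : w ≠ e2 := fun hh => hz (hh ▸ p.left)
      have heT : e2 ∉ T := fun hh => hwe (hT hh)
      refine TP.mk' (e1 := e2) (a1 := a1) (a2 := a2) (e2 := f) (S2 := T ∪ S) q1 ⟨⟨_, c.append p ?_⟩, ha2, hf, ?_, ?_⟩ ?_ ha (Or.inl rfl)
      · exact fun x hx hx' => hD x hx' (Or.inl (Or.inr (hTS hx)))
      · rintro x (hx | hx) hxA
        · exact hA2 x (hTS hx) hxA
        · have := hD x hx (Or.inr hxA)
          subst this
          exact hA2 _ hw2 hxA
      · rintro x (hx | hx) hxA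
        · have := hS2B x (hTS hx) hxA
          subst this
          exact absurd hx heT
        · exact hE x hx hxA
      · rintro x (rfl | hx) (hx2 | hx2)
        · exact heT hx2
        · exact hz hx2
        · exact hd x hx (hTS hx2)
        · have := hD x hx2 (Or.inl (Or.inl hx))
          subst this
          exact hw1 hx
    have hwA : w ∈ A := by
      rcases hw with (hw | hw) | hw
      · exact absurd hw hw1
      · exact absurd hw hw2
      · exact hw
    have q3 : AB G A B' w f S := ⟨⟨_, p⟩, hwA, hf, fun x hx hxA => hD x hx (Or.inr hxA), hE⟩
    rcases ha with ha | ha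
    · refine TP.mk' q1 q3 ?_ (Or.inl ha) (Or.inl rfl)
      rintro x (rfl | hx) hxS
      · exact hz hxS
      · have := hD x hxS (Or.inl (Or.inl hx))
        subst this
        exact hw1 hx
    · refine TP.mk' q2 q3 ?_ (Or.inl ha) (Or.inl rfl)
      rintro x hx hxS
      have := hD x hxS (Or.inl (Or.inr hx))
      subst this
      exact hw2 hx
  · refine TP.mk' q1 q2 ?_ ha (Or.inl rfl)
    rintro x (rfl | hx) hx2
    · exact hc (hS2B x hx2 he').symm
    · exact hd x hx hx2

lemma fan_aux [Fintype V] (h2 : TwoConnected G) (A B : Set V) (r : ℕ → V) (s : ℕ)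
    (hadj : ∀ i < s, G.Adj (r i) (r (i + 1))) (hinj : ∀ i ≤ s, ∀ j ≤ s, r i = r j → i = j)
    (hrA : ∀ i, 1 ≤ i → i ≤ s → r i ∉ A) (hr0 : r 0 ∈ A) (hrB : ∀ i < s, r i ∉ B)
    (hrs : r s ∈ B) (hA : ∃ a ∈ A, a ≠ r 0) (hB : ∃ b ∈ B, b ≠ r s) (i : ℕ) (hi : i ≤ s) :
    TP G A (B ∪ {x | ∃ j, i ≤ j ∧ j ≤ s ∧ x = r j}) (r 0) (r i) := by
  have hex : ∀ i ≤ s, ∃ b ∈ (B ∪ {x | ∃ j, i ≤ j ∧ j ≤ s ∧ x = r j}), b ≠ r i := by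
    intro i hi
    rcases hi.eq_or_lt with rfl | hlt
    · obtain ⟨b, hb, h⟩ := hB
      exact ⟨b, Or.inl hb, h⟩
    · exact ⟨r s, Or.inl hrs, fun hh => by have := hinj s le_rfl i hi hh; omega⟩
  induction i with
  | zero =>
    obtain ⟨a, ha, ha0⟩ := hA
    obtain ⟨b, hb, hb0⟩ := hex 0 hi
    obtain ⟨w, hw, e, he, S, n, p, hz, hD, hE⟩ := connPath h2 A _ (r 0) a b ha ha0 hb hb0
    refine TP.mk' (a1 := r 0) (e1 := r 0) (S1 := {r 0}) (a2 := w) (e2 := e) (S2 := S)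
      ⟨⟨0, PO.nil _ _⟩, hr0, Or.inr ⟨0, le_rfl, hi, rfl⟩, ?_, ?_⟩ ⟨⟨n, p⟩, hw, he, hD, hE⟩ ?_ (Or.inl rfl) (Or.inl rfl)
    · intro x hx _; exact hx
    · intro x hx _; exact hx
    · rintro x rfl; exact hz
  | succ i ih =>
    refine (ih (by omega)).step h2 hr0 ?_ (hadj i (by omega)) (Or.inr ⟨i + 1, le_rfl, hi, rfl⟩)
      (hrA _ (by omega) hi) (hex _ hi)
    intro x
    constructor
    · rintro (hx | ⟨j, h1, h2, rfl⟩)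
      · exact ⟨Or.inl hx, fun hh => hrB i (by omega) (hh ▸ hx)⟩
      · exact ⟨Or.inr ⟨j, by omega, h2, rfl⟩, fun hh => by have := hinj j h2 i (by omega) hh; omega⟩
    · rintro ⟨hx | ⟨j, h1, h2, rfl⟩, hne⟩
      · exact Or.inl hx
      · refine Or.inr ⟨j, ?_, h2, rfl⟩
        rcases h1.eq_or_lt with rfl | h
        · exact absurd rfl hne
        · omega

/-- Two disjoint `A`-`B` paths preserving the ends of a given `A`-`B` path. -/
lemma fan [Fintype V] (h2 : TwoConnected G) (A B : Set V) (a b : V) (S : Set V)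
    (h : AB G A B a b S) (hA : ∃ x ∈ A, x ≠ a) (hB : ∃ x ∈ B, x ≠ b) : TP G A B a b := by
  obtain ⟨⟨n, w, hw, hn, hS⟩, ha, hb, hSA, hSB⟩ := h
  have hmem : ∀ i, w.getVert i ∈ S := fun i => by
    rw [← hS]; exact w.getVert_mem_support i
  have hinj : ∀ i ≤ n, ∀ j ≤ n, w.getVert i = w.getVert j → i = j := by
    intro i hi j hj hij
    exact hw.getVert_injOn (by simp; omega) (by simp; omega) hij
  have h0 : w.getVert 0 = a := by simp
  have h1 : w.getVert n = b := by rw [← hn]; simp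
  have := fan_aux h2 A B w.getVert n (fun i hi => w.adj_getVert_succ (by omega)) hinj
    (fun i h1 h2 hh => by
      have := hSA _ (hmem i) hh
      have := hinj i h2 0 (by omega) (this.trans h0.symm)
      omega) (by rw [h0]; exact ha)
    (fun i hi hh => by
      have := hSB _ (hmem i) hh
      have := hinj i hi.le n le_rfl (this.trans h1.symm)
      omega) (by rw [h1]; exact hb) (by rwa [h0]) (by rwa [h1]) n le_rfl
  rw [h0, h1] at this
  have hBB : B ∪ {x | ∃ j, n ≤ j ∧ j ≤ n ∧ x = w.getVert j} = B := by
    apply Set.union_eq_left.2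
    rintro x ⟨j, h3, h4, rfl⟩
    have : j = n := by omega
    rw [this, h1]; exact hb
  rwa [hBB] at this

end Fan

/-- `p 0, …, p (m-1)` is a path. -/
def PF {V : Type*} (G : SimpleGraph V) (p : ℕ → V) (m : ℕ) : Prop :=
  (∀ i, i + 1 < m → G.Adj (p i) (p (i + 1))) ∧ ∀ i < m, ∀ j < m, p i = p j → i = j

/-- Every vertex of `A` other than `r` is linked to `r` inside `A` by a path of length `≥ L`. -/
def Link {V : Type*} (G : SimpleGraph V) (A : Set V) (r : V) (L : ℕ) : Prop :=
  ∀ a ∈ A, a ≠ r → ∃ S n, PO G a r S n ∧ S ⊆ A ∧ L ≤ n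

section Core
variable {V : Type*} {G : SimpleGraph V}

lemma PF.seg {p : ℕ → V} {m : ℕ} (h : PF G p m) (a b : ℕ) (hab : a ≤ b) (hb : b < m) :
    PO G (p a) (p b) {x | ∃ i, a ≤ i ∧ i ≤ b ∧ x = p i} (b - a) := by
  induction b, hab using Nat.le_induction with
  | base =>
    have : {x | ∃ i, a ≤ i ∧ i ≤ a ∧ x = p i} = {p a} := by
      ext x
      constructor
      · rintro ⟨i, h1, h2, rfl⟩
        have : i = a := by omega
        rw [this]; rfl
      · rintro rfl; exact ⟨a, le_rfl, le_rfl, rfl⟩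
    rw [this, Nat.sub_self]; exact PO.nil _ _
  | succ b hab ih =>
    have h1 := (ih (by omega)).snoc (h.1 b hb) (by
      rintro ⟨i, h1, h2, h3⟩
      have := h.2 _ hb _ (by omega) h3
      omega)
    have : insert (p (b + 1)) {x | ∃ i, a ≤ i ∧ i ≤ b ∧ x = p i} =
        {x | ∃ i, a ≤ i ∧ i ≤ b + 1 ∧ x = p i} := by
      ext x
      constructor
      · rintro (rfl | ⟨i, h1, h2, rfl⟩)
        · exact ⟨b + 1, by omega, le_rfl, rfl⟩
        · exact ⟨i, h1, by omega, rfl⟩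
      · rintro ⟨i, h1, h2, rfl⟩
        rcases h2.eq_or_lt with rfl | h2
        · exact Or.inl rfl
        · exact Or.inr ⟨i, h1, by omega, rfl⟩
    rw [this] at h1
    have e : b + 1 - a = b - a + 1 := by omega
    rwa [e]

lemma PO.toPF {u v : V} {S : Set V} {n : ℕ} (h : PO G u v S n) :
    ∃ p : ℕ → V, PF G p (n + 1) ∧ p 0 = u ∧ p n = v ∧ S = {x | ∃ i, i ≤ n ∧ x = p i} := by
  obtain ⟨w, hw, hn, hS⟩ := h
  refine ⟨w.getVert, ⟨fun i hi => w.adj_getVert_succ (by omega), ?_⟩, by simp, ?_, ?_⟩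
  · intro i hi j hj hij
    exact hw.getVert_injOn (by simp; omega) (by simp; omega) hij
  · rw [← hn]; simp
  · rw [← hS]
    ext x
    simp only [Set.mem_ofPred_eq]
    rw [Walk.mem_support_iff_exists_getVert]
    constructor
    · rintro ⟨i, h1, h2⟩; exact ⟨i, by omega, h1.symm⟩
    · rintro ⟨i, h1, h2⟩; exact ⟨i, h2.symm, by omega⟩

lemma PF.rev {p : ℕ → V} {m : ℕ} (h : PF G p m) : PF G (fun i => p (m - 1 - i)) m := by
  constructor
  · intro i hi
    have := (h.1 (m - 1 - (i + 1)) (by omega)).symm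
    have e : m - 1 - (i + 1) + 1 = m - 1 - i := by omega
    rwa [e] at this
  · intro i hi j hj hij
    have := h.2 _ (by omega) _ (by omega) hij
    omega

lemma PF.link {p : ℕ → V} {m : ℕ} (h : PF G p m) (N : Finset ℕ) (L : ℕ) (hL : 1 ≤ L)
    (hN : ∀ i ∈ N, 1 ≤ i ∧ i < m ∧ G.Adj (p 0) (p i)) (hc : L ≤ N.card) :
    ∃ g ∈ N, (∀ i ∈ N, i ≤ g) ∧ Link G {x | ∃ i, i ≤ g ∧ x = p i} (p g) L := by
  have hne : N.Nonempty := by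
    rw [← Finset.card_pos]; omega
  obtain ⟨g, hg, hmax⟩ := N.exists_max_image id hne
  refine ⟨g, hg, hmax, ?_⟩
  rintro _ ⟨a, hag, rfl⟩ hne'
  have hag' : a < g := lt_of_le_of_ne hag (fun hh => hne' (by rw [hh]))
  have hF : (N.filter (a < ·)).Nonempty := ⟨g, by simp [hg, hag']⟩
  obtain ⟨i, hi, hmin⟩ := (N.filter (a < ·)).exists_min_image id hF
  simp only [Finset.mem_filter, id] at hi hmin hmax
  obtain ⟨hg1, hg2, hg3⟩ := hN g hg
  obtain ⟨hi1, hi2, hi3⟩ := hN i hi.1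
  have hig := hmax i hi.1
  have q1 := (h.seg 0 a (by omega) (by omega)).rev
  have q2 := h.seg i g hig hg2
  have q3 := q1.snoc hi3 (by
    rintro ⟨j, h1, h2, h3⟩
    have := h.2 _ hi2 _ (by omega) h3
    omega)
  have q4 := q3.append q2 (by
    rintro x (rfl | ⟨j, h1, h2, rfl⟩) ⟨l, h4, h5, h6⟩
    · rfl
    · have := h.2 _ (by omega) _ (by omega) h6
      omega)
  refine ⟨_, _, q4, ?_, ?_⟩
  · rintro x ((rfl | ⟨j, h1, h2, rfl⟩) | ⟨j, h1, h2, rfl⟩)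
    · exact ⟨i, hig, rfl⟩
    · exact ⟨j, by omega, rfl⟩
    · exact ⟨j, by omega, rfl⟩
  · have : N ⊆ Finset.Icc 1 a ∪ Finset.Icc i g := by
      intro j hj
      have h1 := hN j hj
      have h2 := hmax j hj
      by_cases haj : a < j
      · have := hmin j ⟨hj, haj⟩
        simp; omega
      · simp; omega
    have := (Finset.card_le_card this).trans (Finset.card_union_le _ _)
    simp at this
    omega

lemma link_cycle [Fintype V] (h2 : TwoConnected G) {A B : Set V} {r s : V} {S : Set V} {L k : ℕ}
    (hA : Link G A r L) (hB : Link G B s L) (hS : AB G A B r s S) (hAB : ∀ x ∈ A, x ∈ B → x = r)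
    (hA2 : ∃ x ∈ A, x ≠ r) (hB2 : ∃ x ∈ B, x ≠ s) (hL : 2 ≤ L) (hk : k ≤ 2 * L) :
    HasCycleGE G k := by
  obtain ⟨a1, a2, e1, e2, S1, S2, ⟨⟨n1, p1⟩, ha1, he1, hA1, hB1⟩, ⟨⟨n2, p2⟩, ha2, he2, hA2', hB2'⟩,
    hd, ha, rfl⟩ := fan h2 A B r s S hS hA2 hB2
  have hae : a1 ≠ a2 := fun hh => hd _ p1.left (hh ▸ p2.left)
  have hee : e2 ≠ e1 := fun hh => hd _ p1.right (hh ▸ p2.right)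
  obtain ⟨SB, nB, pB, hSB, hnB⟩ := hB e2 he2 hee
  rcases ha with rfl | rfl
  · obtain ⟨SA, nA, pA, hSA, hnA⟩ := hA a2 ha2 hae.symm
    refine PO.cycle (pA.append p1 ?_) (pB.rev.append p2.rev ?_) ?_ ?_ (k := k) (by omega) (by omega)
    · intro x hx hx'; exact hA1 x hx' (hSA hx)
    · intro x hx hx'; exact hB2' x hx' (hSB hx)
    · intro hh; exact hd _ p1.right (hh ▸ p2.left)
    · rintro x (hx | hx) (hx' | hx')
      · right
        have := hAB x (hSA hx) (hSB hx')
        subst this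
        exact hB1 _ p1.left (hSB hx')
      · left; exact hA2' x hx' (hSA hx)
      · right; exact hB1 x hx (hSB hx')
      · exact absurd hx' (hd x hx)
  · obtain ⟨SA, nA, pA, hSA, hnA⟩ := hA a1 ha1 hae
    refine PO.cycle (pA.append p2 ?_) (pB.append p1.rev ?_) ?_ ?_ (k := k) (by omega) (by omega)
    · intro x hx hx'; exact hA2' x hx' (hSA hx)
    · intro x hx hx'; exact hB1 x hx' (hSB hx)
    · intro hh; exact hd _ p1.left (hh ▸ p2.right)
    · rintro x (hx | hx) (hx' | hx')
      · right
        have := hAB x (hSA hx) (hSB hx')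
        subst this
        exact hB2' _ p2.left (hSB hx')
      · left; exact hA1 x hx' (hSA hx)
      · right; exact hB2' x hx (hSB hx')
      · exact absurd hx (hd x hx')

end Core

section Core2
variable {V : Type*} {G : SimpleGraph V}

lemma PF.closed_cycle {p : ℕ → V} {m k : ℕ} (h : PF G p m) (hm : 3 ≤ m) (hk : k ≤ m)
    (ha : G.Adj (p (m - 1)) (p 0)) : HasCycleGE G k := by
  have q1 := h.seg 0 (m - 1) (by omega) (by omega)
  refine PO.cycle q1 (PO.edge ha) ?_ ?_ (k := k) (by omega) (by omega)
  · intro hh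
    have := h.2 _ (by omega) _ (by omega) hh
    omega
  · rintro x _ (rfl | rfl)
    · exact Or.inr rfl
    · exact Or.inl rfl

lemma bondy [Fintype V] (h2 : TwoConnected G) {p : ℕ → V} {m L : ℕ} (h : PF G p m) (hL : 2 ≤ L)
    (Nx Ny : Finset ℕ) (hNx : ∀ i ∈ Nx, 1 ≤ i ∧ i < m ∧ G.Adj (p 0) (p i))
    (hNy : ∀ j ∈ Ny, j + 1 < m ∧ G.Adj (p (m - 1)) (p j)) (hcx : L ≤ Nx.card) (hcy : L ≤ Ny.card) :
    HasCycleGE G (2 * L) ∨ ∃ j, j + 1 < m ∧ G.Adj (p (m - 1)) (p j) ∧ G.Adj (p 0) (p (j + 1)) := by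
  by_cases hov : ∃ i ∈ Nx, ∃ j ∈ Ny, j < i
  · have hex : ∃ d, ∃ i ∈ Nx, ∃ j ∈ Ny, j < i ∧ i - j = d := by
      obtain ⟨i, hi, j, hj, hij⟩ := hov
      exact ⟨_, i, hi, j, hj, hij, rfl⟩
    classical
    obtain ⟨i, hi, j, hj, hij, hd⟩ := Nat.find_spec hex
    have hmin : ∀ i' ∈ Nx, ∀ j' ∈ Ny, j' < i' → i - j ≤ i' - j' := by
      intro i' hi' j' hj' hij'
      rw [hd]
      exact Nat.find_min' hex ⟨i', hi', j', hj', hij', rfl⟩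
    obtain ⟨hi1, hi2, hi3⟩ := hNx i hi
    obtain ⟨hj1, hj2⟩ := hNy j hj
    by_cases h1 : i = j + 1
    · right; exact ⟨j, hj1, hj2, h1 ▸ hi3⟩
    left
    have hcard : Nx.card + Ny.card ≤ j + 1 + (m - i) := by
      have hdis : Disjoint ((Nx.erase i).image (· - 1)) Ny := by
        rw [Finset.disjoint_left]
        intro a ha ha'
        simp only [Finset.mem_image, Finset.mem_erase] at ha
        obtain ⟨l, ⟨hl, hl'⟩, rfl⟩ := ha
        have := hNx l hl'
        have := hmin l hl' (l - 1) ha' (by omega)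
        omega
      have hinj : ((Nx.erase i).image (· - 1)).card = Nx.card - 1 := by
        rw [Finset.card_image_of_injOn, Finset.card_erase_of_mem hi]
        intro a ha b hb hab
        simp at ha hb hab
        have := hNx a ha.1
        have := hNx b hb.1
        omega
      have hnm : m - 1 ∉ (Nx.erase i).image (· - 1) ∪ Ny := by
        simp only [Finset.mem_union, Finset.mem_image, Finset.mem_erase]
        rintro (⟨l, ⟨hl, hl'⟩, h3⟩ | h3)
        · have := hNx l hl'
          omega
        · have := hNy _ h3
          omega
      have hsub : insert (m - 1) ((Nx.erase i).image (· - 1) ∪ Ny) ⊆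
          Finset.Icc 0 j ∪ Finset.Ico i m := by
        intro a ha
        simp only [Finset.mem_insert, Finset.mem_union, Finset.mem_image, Finset.mem_erase] at ha
        simp only [Finset.mem_union, Finset.mem_Icc, Finset.mem_Ico]
        rcases ha with rfl | ⟨l, ⟨hl, hl'⟩, rfl⟩ | ha
        · omega
        · have := hNx l hl'
          by_contra hcon
          have := hmin l hl' j hj (by omega)
          omega
        · have := hNy a ha
          by_contra hcon
          have := hmin i hi a ha (by omega)
          omega
      have := (Finset.card_le_card hsub).trans (Finset.card_union_le _ _)
      rw [Finset.card_insert_of_notMem hnm, Finset.card_union_of_disjoint hdis, hinj] at this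
      simp at this
      have : 1 ≤ Nx.card := by omega
      omega
    have q1 := (h.seg 0 j (by omega) (by omega)).snoc hj2.symm (by
      rintro ⟨l, h1, h2, h3⟩
      have := h.2 _ (by omega) _ (by omega) h3
      omega)
    have q2 := (h.seg i (m - 1) (by omega) (by omega)).rev.snoc hi3.symm (by
      rintro ⟨l, h1, h2, h3⟩
      have := h.2 _ (by omega) _ (by omega) h3
      omega)
    refine PO.cycle q1 q2 ?_ ?_ (k := 2 * L) (by omega) (by omega)
    · intro hh
      have := h.2 _ (by omega) _ (by omega) hh
      omega
    · rintro x (rfl | ⟨l, h1, h2, rfl⟩) (h3 | ⟨l', h1', h2', h3⟩)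
      · exact Or.inl h3
      · exact Or.inr rfl
      · exact Or.inl h3
      · have := h.2 _ (by omega) _ (by omega) h3
        omega
  · left
    push Not at hov
    obtain ⟨g, hg, hgm, hl⟩ := h.link Nx L (by omega) hNx hcx
    have hinj : Set.InjOn (fun j => m - 1 - j) (Ny : Set ℕ) := by
      intro a ha b hb hab
      have := hNy a ha
      have := hNy b hb
      simp only at hab
      omega
    obtain ⟨g', hg', hgm', hl'⟩ := h.rev.link (Ny.image (fun j => m - 1 - j)) L (by omega) (by
      intro i hi
      obtain ⟨j, hj, rfl⟩ := Finset.mem_image.1 hi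
      obtain ⟨h3, h4⟩ := hNy j hj
      have e : m - 1 - (m - 1 - j) = j := by omega
      have e0 : m - 1 - 0 = m - 1 := by omega
      rw [e, e0]
      exact ⟨by omega, by omega, h4⟩) (by
      rw [Finset.card_image_of_injOn hinj]; exact hcy)
    obtain ⟨f, hf, rfl⟩ := Finset.mem_image.1 hg'
    obtain ⟨hf1, hf2⟩ := hNy f hf
    obtain ⟨hg1, hg2, hg3⟩ := hNx g hg
    have hgf := hov g hg f hf
    have e : m - 1 - (m - 1 - f) = f := by omega
    simp only [e] at hl'
    refine link_cycle h2 hl hl' (S := {x | ∃ i, g ≤ i ∧ i ≤ f ∧ x = p i})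
      ⟨⟨_, h.seg g f hgf (by omega)⟩, ⟨g, le_rfl, rfl⟩, ⟨m - 1 - f, le_rfl, by rw [e]⟩, ?_, ?_⟩
      ?_ ⟨p 0, ⟨0, by omega, rfl⟩, ?_⟩ ⟨p (m - 1), ⟨0, by omega, by simp⟩, ?_⟩ hL le_rfl
    · rintro x ⟨i, h1, h2, rfl⟩ ⟨l, h3, h4⟩
      have := h.2 _ (by omega) _ (by omega) h4
      congr 1; omega
    · rintro x ⟨i, h1, h2, rfl⟩ ⟨l, h3, h4⟩
      have := h.2 _ (by omega) _ (by omega) h4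
      congr 1; omega
    · rintro x ⟨i, h1, rfl⟩ ⟨l, h3, h4⟩
      have := h.2 _ (by omega) _ (by omega) h4
      congr 1; omega
    · intro hh
      have := h.2 _ (by omega) _ (by omega) hh
      omega
    · intro hh
      have := h.2 _ (by omega) _ (by omega) hh
      omega

lemma PF.cons {p : ℕ → V} {m : ℕ} (h : PF G p m) (z : V) (hz : G.Adj z (p 0))
    (hn : ∀ i < m, z ≠ p i) : PF G (fun i => if i = 0 then z else p (i - 1)) (m + 1) := by
  constructor
  · intro i hi
    rcases Nat.eq_zero_or_pos i with rfl | h0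
    · simpa using hz
    · have := h.1 (i - 1) (by omega)
      have e : i - 1 + 1 = i := by omega
      rw [e] at this
      simpa [h0.ne'] using this
  · intro i hi j hj hij
    by_cases h0 : i = 0 <;> by_cases h1 : j = 0
    · omega
    · simp [h0, h1] at hij
      exact absurd hij (hn _ (by omega))
    · simp [h0, h1] at hij
      exact absurd hij.symm (hn _ (by omega))
    · simp [h0, h1] at hij
      have := h.2 _ (by omega) _ (by omega) hij
      omega

lemma PF.card_le {p : ℕ → V} {m : ℕ} (h : PF G p m) (K : Finset V) (hK : ∀ i < m, p i ∈ K) :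
    m ≤ K.card := by
  have := Finset.card_le_card_of_injOn (s := Finset.range m) p (t := K)
    (fun i hi => hK i (by simpa using hi))
    (fun i hi j hj hij => h.2 i (by simpa using hi) j (by simpa using hj) hij)
  simpa using this

lemma exists_greatest (P : ℕ → Prop) (b m0 : ℕ) (h0 : P m0) (hb : ∀ m, P m → m ≤ b) :
    ∃ m, P m ∧ ∀ m', P m' → m' ≤ m := by
  classical
  exact ⟨Nat.findGreatest P b, Nat.findGreatest_spec (hb _ h0) h0,
    fun m' hm' => Nat.le_findGreatest (hb _ hm') hm'⟩

lemma PF.nbr_count {p : ℕ → V} {m L : ℕ} (K : Finset V) (v : V)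
    (hv : ∀ z ∈ K, G.Adj v z → ∃ i < m, z = p i) 
    (hd : L ≤ {z ∈ (K : Set V) | G.Adj v z}.ncard) :
    ∃ N : Finset ℕ, (∀ i ∈ N, i < m ∧ G.Adj v (p i)) ∧ L ≤ N.card := by
  classical
  refine ⟨(Finset.range m).filter (fun i => G.Adj v (p i)), by simp, hd.trans ?_⟩
  have : {z ∈ (K : Set V) | G.Adj v z} ⊆
      (((Finset.range m).filter (fun i => G.Adj v (p i))).image p : Finset V) := by
    rintro z ⟨hz, hvz⟩
    obtain ⟨i, hi, rfl⟩ := hv z hz hvz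
    simp only [Finset.coe_image, Set.mem_image, Finset.mem_coe, Finset.mem_filter, Finset.mem_range]
    exact ⟨i, ⟨hi, hvz⟩, rfl⟩
  have := Set.ncard_le_ncard this (Finset.finite_toSet _)
  rw [Set.ncard_coe_finset] at this
  exact this.trans Finset.card_image_le

lemma PF.single (G : SimpleGraph V) (u : V) : PF G (fun _ => u) 1 :=
  ⟨fun i hi => by omega, fun i hi j hj _ => by omega⟩

lemma lollipop {L : ℕ} (hL : 1 ≤ L) (K : Finset V) (u : V) (hu : u ∈ K)
    (hK : ∀ v ∈ K, L ≤ {z ∈ (K : Set V) | G.Adj v z}.ncard) :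
    ∃ A : Set V, ∃ r S, A ⊆ K ∧ r ∈ A ∧ Link G A r L ∧ (∃ x ∈ A, x ≠ r) ∧ (∃ n, PO G r u S n) ∧
      S ⊆ K ∧ ∀ x ∈ S, x ∈ A → x = r := by
  obtain ⟨m, ⟨hm1, p, hp, hpK, hpu⟩, hmax⟩ := exists_greatest
    (fun m => 1 ≤ m ∧ ∃ p, PF G p m ∧ (∀ i < m, p i ∈ K) ∧ p (m - 1) = u) K.card 1
    ⟨le_rfl, fun _ => u, PF.single G u, fun _ _ => hu, rfl⟩
    (by rintro m ⟨_, p, hp, hpK, _⟩; exact hp.card_le K hpK)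
  obtain ⟨N, hN, hNL⟩ := PF.nbr_count (p := p) (m := m) K (p 0) (by
    intro z hz hadj
    by_contra hcon
    push Not at hcon
    have := hmax (m + 1) ⟨by omega, _, hp.cons z hadj.symm hcon, ?_, ?_⟩
    · omega
    · intro i hi
      by_cases h0 : i = 0
      · simpa [h0] using hz
      · simpa [h0] using hpK _ (by omega)
    · have : m ≠ 0 := by omega
      simpa [this] using hpu) (hK _ (hpK 0 (by omega)))
  obtain ⟨g, hg, hgm, hl⟩ := hp.link N L hL (by
    intro i hi
    obtain ⟨h1, h2⟩ := hN i hi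
    refine ⟨?_, h1, h2⟩
    by_contra h0
    have : i = 0 := by omega
    subst this
    exact h2.ne rfl) hNL
  have hg1 := hN g hg
  refine ⟨{x | ∃ i, i ≤ g ∧ x = p i}, p g, {x | ∃ i, g ≤ i ∧ i ≤ m - 1 ∧ x = p i}, ?_, ⟨g, le_rfl, rfl⟩, hl, ⟨p 0, ⟨0, by omega, rfl⟩, hg1.2.ne⟩,
    ⟨_, hpu ▸ hp.seg g (m - 1) (by omega) (by omega)⟩, ?_, ?_⟩
  · rintro x ⟨i, hi, rfl⟩; exact hpK i (by omega)
  · rintro x ⟨i, hi, hi', rfl⟩; exact hpK i (by omega)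
  · rintro x ⟨i, h1, h2, rfl⟩ ⟨l, h3, h4⟩
    have := hp.2 _ (by omega) _ (by omega) h4
    congr 1; omega

lemma PF.rotate {c : ℕ → V} {m : ℕ} (h : PF G c m) (hm : 2 ≤ m)
    (ha : G.Adj (c (m - 1)) (c 0)) (a : ℕ) (ha' : a < m) :
    PF G (fun s => c ((s + a) % m)) m := by
  constructor
  · intro i hi
    by_cases h1 : i + a + 1 < m
    · have e1 : (i + a) % m = i + a := Nat.mod_eq_of_lt (by omega)
      have e2 : (i + 1 + a) % m = i + a + 1 := by rw [Nat.mod_eq_of_lt (by omega)]; omega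
      simp only [e1, e2]
      exact h.1 _ h1
    by_cases h2 : i + a + 1 = m
    · have e1 : (i + a) % m = m - 1 := by rw [Nat.mod_eq_of_lt (by omega)]; omega
      have e2 : (i + 1 + a) % m = 0 := by
        have : i + 1 + a = m := by omega
        rw [this, Nat.mod_self]
      simp only [e1, e2]
      exact ha
    · have e1 : (i + a) % m = i + a - m := by
        rw [Nat.mod_eq_sub_mod (by omega), Nat.mod_eq_of_lt (by omega)]
      have e2 : (i + 1 + a) % m = i + a - m + 1 := by
        rw [Nat.mod_eq_sub_mod (by omega), Nat.mod_eq_of_lt (by omega)]; omega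
      simp only [e1, e2]
      exact h.1 _ (by omega)
  · intro i hi j hj hij
    have := h.2 _ (Nat.mod_lt _ (by omega)) _ (Nat.mod_lt _ (by omega)) hij
    have h3 : i + a ≡ j + a [MOD m] := this
    have h4 := Nat.ModEq.add_right_cancel' a h3
    exact Nat.ModEq.eq_of_lt_of_lt h4 hi hj

theorem core_bound [Fintype V] (h2 : TwoConnected G) {L : ℕ} (hL : 2 ≤ L)
    (hcyc : ¬ HasCycleGE G (2 * L)) (K : Finset V)
    (hK : ∀ v ∈ K, L ≤ {z ∈ (K : Set V) | G.Adj v z}.ncard) : K.card < 2 * L := by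
  classical
  by_contra hcard
  push Not at hcard
  have hne : K.Nonempty := by rw [← Finset.card_pos]; omega
  obtain ⟨u, hu⟩ := hne
  obtain ⟨m, ⟨hm1, p, hp, hpK⟩, hmax⟩ := exists_greatest
    (fun m => 1 ≤ m ∧ ∃ p, PF G p m ∧ (∀ i < m, p i ∈ K)) K.card 1
    ⟨le_rfl, fun _ => u, PF.single G u, fun _ _ => hu⟩
    (by rintro m ⟨_, p, hp, hpK⟩; exact hp.card_le K hpK)
  -- start of a longest path has all its neighbours on the path
  have hend : ∀ q : ℕ → V, PF G q m → (∀ i < m, q i ∈ K) → ∀ z ∈ K, G.Adj (q 0) z →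
      ∃ i < m, z = q i := by
    intro q hq hqK z hz hadj
    by_contra hcon
    push Not at hcon
    have := hmax (m + 1) ⟨by omega, _, hq.cons z hadj.symm hcon, ?_⟩
    · omega
    · intro i hi
      by_cases h0 : i = 0
      · simpa [h0] using hz
      · simpa [h0] using hqK _ (by omega)
  obtain ⟨Nx, hNx, hNxL⟩ := PF.nbr_count (p := p) (m := m) K (p 0) (hend p hp hpK)
    (hK _ (hpK 0 (by omega)))
  obtain ⟨Ny, hNy, hNyL⟩ := PF.nbr_count (p := p) (m := m) K (p (m - 1)) (by
    intro z hz hadj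
    obtain ⟨i, hi, h⟩ := hend _ hp.rev (fun i hi => hpK _ (by omega)) z hz (by simpa using hadj)
    exact ⟨m - 1 - i, by omega, h⟩) (hK _ (hpK _ (by omega)))
  rcases bondy h2 hp hL Nx Ny (by
      intro i hi
      obtain ⟨h1, h2⟩ := hNx i hi
      refine ⟨?_, h1, h2⟩
      by_contra h0
      have : i = 0 := by omega
      subst this
      exact h2.ne rfl) (by
      intro i hi
      obtain ⟨h1, h2⟩ := hNy i hi
      refine ⟨?_, h2⟩
      by_contra h0
      have : i = m - 1 := by omega
      subst this
      exact h2.ne rfl) hNxL hNyL with hc | ⟨j, hj, hj1, hj2⟩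
  · exact hcyc hc
  have hm : L + 1 ≤ m := by
    have : Nx ⊆ (Finset.range m).erase 0 := by
      intro i hi
      obtain ⟨h1, h2⟩ := hNx i hi
      have : i ≠ 0 := by rintro rfl; exact h2.ne rfl
      simp [h1, this]
    have := Finset.card_le_card this
    rw [Finset.card_erase_of_mem (by simp; omega)] at this
    simp at this
    omega
  -- the spanning cycle
  let c : ℕ → V := fun s => if s ≤ j then p s else p (m + j - s)
  have hc : PF G c m := by
    constructor
    · intro i hi
      by_cases h1 : i + 1 ≤ j
      · have : i ≤ j := by omega
        simp only [c, h1, this, if_true]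
        exact hp.1 i hi
      · by_cases h3 : i ≤ j
        · have e : m + j - (i + 1) = m - 1 := by omega
          have e' : i = j := by omega
          simp only [c, h1, h3, if_true, if_false, e]
          rw [e']; exact hj1.symm
        · simp only [c, h1, h3, if_false]
          have := (hp.1 (m + j - (i + 1)) (by omega)).symm
          have e : m + j - (i + 1) + 1 = m + j - i := by omega
          rwa [e] at this
    · intro i hi l hl hil
      by_cases h1 : i ≤ j <;> by_cases h3 : l ≤ j <;> simp only [c, h1, h3, if_true, if_false] at hil
      all_goals
        have := hp.2 _ (by omega) _ (by omega) hil
        omega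
  have hclose : G.Adj (c (m - 1)) (c 0) := by
    have h1 : ¬ (m - 1 ≤ j) := by omega
    have e : m + j - (m - 1) = j + 1 := by omega
    simp only [c, h1, if_false, e, Nat.zero_le, if_true]
    exact hj2.symm
  have hcK : ∀ i < m, c i ∈ K := by
    intro i hi
    by_cases h1 : i ≤ j
    · simp only [c, h1, if_true]; exact hpK _ (by omega)
    · simp only [c, h1, if_false]; exact hpK _ (by omega)
  have hm2 : m < 2 * L := by
    by_contra hcon
    exact hcyc (hc.closed_cycle (by omega) (by omega) hclose)
  let D : Finset V := (Finset.range m).image c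
  have hDK : D ⊆ K := by
    intro x hx
    obtain ⟨i, hi, rfl⟩ := Finset.mem_image.1 hx
    exact hcK i (by simpa using hi)
  have hclosed : ∀ v ∈ D, ∀ z ∈ K, G.Adj v z → z ∈ D := by
    intro v hv z hz hadj
    obtain ⟨a, ha, rfl⟩ := Finset.mem_image.1 hv
    have ha : a < m := by simpa using ha
    have hr := hc.rotate (by omega) hclose a ha
    obtain ⟨i, hi, rfl⟩ := hend _ hr (fun i hi => hcK _ (Nat.mod_lt _ (by omega))) z hz (by
      simpa [Nat.mod_eq_of_lt ha] using hadj)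
    exact Finset.mem_image.2 ⟨_, by simpa using Nat.mod_lt _ (by omega), rfl⟩
  have hDcard : D.card ≤ m := by simpa using Finset.card_image_le (s := Finset.range m) (f := c)
  obtain ⟨b, hb⟩ : (K \ D).Nonempty := by
    rw [← Finset.card_pos, Finset.card_sdiff_of_subset hDK]; omega
  have hd0 : c 0 ∈ D := Finset.mem_image.2 ⟨0, by simp; omega, rfl⟩
  have hd1 : c 1 ∈ D := Finset.mem_image.2 ⟨1, by simp; omega, rfl⟩
  have h01 : c 0 ≠ c 1 := fun hh => by
    have := hc.2 0 (by omega) 1 (by omega) hh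
    omega
  obtain ⟨w, hw, e, he, S0, n0, p0, -, hS0D, hS0B⟩ := connPath h2 (D : Set V) ((K \ D : Finset V) : Set V) (c 1) (c 0) b
    hd0 h01 hb (by rintro rfl; exact (Finset.mem_sdiff.1 hb).2 hd1)
  have hKD : ∀ v ∈ D, L ≤ {z ∈ (D : Set V) | G.Adj v z}.ncard := by
    intro v hv
    refine (hK v (hDK hv)).trans (Set.ncard_le_ncard ?_ ((Finset.finite_toSet D).subset (Set.sep_subset _ _)))
    rintro z ⟨hz, hvz⟩
    exact ⟨hclosed v hv z hz hvz, hvz⟩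
  have hKB : ∀ v ∈ K \ D, L ≤ {z ∈ ((K \ D : Finset V) : Set V) | G.Adj v z}.ncard := by
    intro v hv
    have hv' := Finset.mem_sdiff.1 hv
    refine (hK v hv'.1).trans (Set.ncard_le_ncard ?_ ((Finset.finite_toSet (K \ D)).subset (Set.sep_subset _ _)))
    rintro z ⟨hz, hvz⟩
    refine ⟨?_, hvz⟩
    have : z ∉ D := fun hzD => hv'.2 (hclosed z hzD v hv'.1 hvz.symm)
    simp only [Finset.mem_coe, Finset.mem_sdiff]
    exact ⟨hz, this⟩
  obtain ⟨A, r, SA, hAD, hrA, hlA, hA2, ⟨nA, pA⟩, hSAD, hSAA⟩ := lollipop (by omega) D w hw hKD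
  obtain ⟨B, s, SB, hBD, hsB, hlB, hB2, ⟨nB, pB⟩, hSBD, hSBB⟩ := lollipop (by omega) (K \ D) e he hKB
  have hdisj : ∀ x, x ∈ (D : Set V) → x ∈ ((K \ D : Finset V) : Set V) → False := by
    intro x hx hx'
    exact (Finset.mem_sdiff.1 hx').2 hx
  refine hcyc (link_cycle h2 hlA hlB (S := SA ∪ S0 ∪ SB) ⟨⟨_, (pA.append p0 ?_).append pB.rev ?_⟩, hrA, hsB, ?_, ?_⟩
    ?_ hA2 hB2 hL le_rfl)
  · intro x hx hx'; exact hS0D x hx' (hSAD hx)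
  · rintro x (hx | hx) hx'
    · exact (hdisj x (hSAD hx) (hSBD hx')).elim
    · exact hS0B x hx (hSBD hx')
  · rintro x ((hx | hx) | hx) hxA
    · exact hSAA x hx hxA
    · have := hS0D x hx (hAD hxA)
      subst this
      exact hSAA _ pA.right hxA
    · exact (hdisj x (hAD hxA) (hSBD hx)).elim
  · rintro x ((hx | hx) | hx) hxA
    · exact (hdisj x (hSAD hx) (hBD hxA)).elim
    · have := hS0B x hx (hBD hxA)
      subst this
      exact hSBB _ pB.right hxA
    · exact hSBB x hx hxA
  · intro x hx hx'
    exact (hdisj x (hAD hx) (hBD hx')).elim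

end Core2

section BPath
variable {V : Type*} {G : SimpleGraph V}

lemma PF.jump {p : ℕ → V} {m k i l s : ℕ} {S : Set V} (hp : PF G p m) (hcyc : ¬ HasCycleGE G k)
    (hk : 3 ≤ k) (hl : l < m) (hi : i < m) (h : PO G (p i) (p l) S s)
    (hS : ∀ x ∈ S, ∀ j < m, x = p j → x = p i ∨ x = p l) : l ≤ i + k := by
  by_contra hh
  push Not at hh
  apply hcyc
  refine PO.cycle h (hp.seg i l (by omega) hl).rev ?_ ?_ (by omega) (by omega)
  · intro h1
    have := hp.2 _ hi _ hl h1
    omega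
  · rintro x hx ⟨j, h1, h2, h3⟩
    exact hS x hx j (by omega) h3

lemma PF.drop {p : ℕ → V} {m s : ℕ} (hp : PF G p m) : PF G (fun i => p (s + i)) (m - s) := by
  refine ⟨fun i hi => hp.1 (s + i) (by omega), fun i hi j hj hij => ?_⟩
  have := hp.2 (s + i) (by omega) (s + j) (by omega) hij
  omega

lemma PF.near {p : ℕ → V} {m k : ℕ} (hp : PF G p m) (hcyc : ¬ HasCycleGE G k)
    (hk : 3 ≤ k) (n : ℕ) : ∀ (q : ℕ → V) (i j : ℕ), PF G q (n + 1) → i < m → j < m →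
    q 0 = p i → q n = p j → j ≤ i + k * n ∧ i ≤ j + k * n := by
  classical
  induction n using Nat.strong_induction_on with
  | _ n ih =>
    intro q i j hq hi hj h0 hn
    rcases Nat.eq_zero_or_pos n with rfl | hpos
    · have := hp.2 _ hi _ hj (h0.symm.trans hn)
      omega
    have hex : ∃ s, 1 ≤ s ∧ s ≤ n ∧ ∃ l < m, q s = p l := ⟨n, hpos, le_rfl, j, hj, hn⟩
    obtain ⟨hs1, hsn, l, hl, hql⟩ := Nat.find_spec hex
    have hmin := fun s hs => Nat.find_min hex (m := s) hs
    generalize Nat.find hex = s at *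
    have hseg := hq.seg 0 s (by omega) (by omega)
    have hS : ∀ x ∈ {x | ∃ a, 0 ≤ a ∧ a ≤ s ∧ x = q a}, ∀ j < m, x = p j → x = p i ∨ x = p l := by
      rintro x ⟨a, -, ha, rfl⟩ b hb hab
      rcases Nat.eq_zero_or_pos a with rfl | ha0
      · left; exact h0
      rcases ha.eq_or_lt with rfl | ha'
      · right; exact hql
      · exact absurd ⟨ha0, by omega, b, hb, hab⟩ (hmin a ha')
    rw [h0, hql] at hseg
    have j1 := hp.jump hcyc hk hl hi hseg hS
    have j2 := hp.jump hcyc hk hi hl hseg.rev (fun x hx b hb hxb => (hS x hx b hb hxb).symm)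
    have ih' := ih (n - s) (by omega) (fun a => q (s + a)) l j
      (by have := hq.drop (s := s); rwa [show n + 1 - s = n - s + 1 by omega] at this) hl hj hql
      (by simp only [show s + (n - s) = n by omega]; exact hn)
    have : k * n = k * (n - s) + k * s := by
      rw [← Nat.mul_add]; congr 1; omega
    have : k ≤ k * s := Nat.le_mul_of_pos_right _ hs1
    omega

lemma PF.bounded [Fintype V] (h2 : TwoConnected G) {p : ℕ → V} {m k : ℕ} (hp : PF G p m)
    (hcyc : ¬ HasCycleGE G k) (hk : 3 ≤ k) : m ≤ k * k + 4 := by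
  by_contra hm
  push Not at hm
  have hk9 : 3 * 3 ≤ k * k := Nat.mul_le_mul hk hk
  have hinj := hp.2
  have hAB : AB G {p 0, p 1} {p (m - 2), p (m - 1)} (p 1) (p (m - 2))
      {x | ∃ i, 1 ≤ i ∧ i ≤ m - 2 ∧ x = p i} := by
    refine ⟨⟨_, hp.seg 1 (m - 2) (by omega) (by omega)⟩, by simp, by simp, ?_, ?_⟩
    · rintro x ⟨i, h1, h3, rfl⟩ (h | h)
      · have := hinj _ (by omega) _ (by omega) h
        omega
      · exact h
    · rintro x ⟨i, h1, h3, rfl⟩ (h | h)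
      · exact h
      · have := hinj _ (by omega) _ (by omega) h
        omega
  obtain ⟨a1, a2, e1, e2, S1, S2, ⟨⟨n1, p1⟩, ha1, he1, hA1, hB1⟩, ⟨⟨n2, p2⟩, ha2, he2, hA2, hB2⟩,
    hd, ha, rfl⟩ := fan h2 _ _ _ _ _ hAB
      ⟨p 0, by simp, fun h => by have := hinj _ (by omega) _ (by omega) h; omega⟩
      ⟨p (m - 1), by simp, fun h => by have := hinj _ (by omega) _ (by omega) h; omega⟩
  have hae : a1 ≠ a2 := fun hh => hd _ p1.left (hh ▸ p2.left)
  have hee : p (m - 2) ≠ e2 := fun hh => hd _ p1.right (hh ▸ p2.right)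
  have he2' : e2 = p (m - 1) := by
    rcases he2 with rfl | h
    · exact absurd rfl hee
    · exact h
  subst he2'
  have hadj : G.Adj (p (m - 2)) (p (m - 1)) := by
    have := hp.1 (m - 2) (by omega)
    rwa [show m - 2 + 1 = m - 1 by omega] at this
  have haa : G.Adj a2 a1 := by
    have h01 := hp.1 0 (by omega)
    rcases ha1 with rfl | h1 <;> rcases ha2 with rfl | h2
    · exact absurd rfl hae
    · rw [h2]; exact h01.symm
    · rw [h1]; exact h01
    · exact absurd (h1.trans h2.symm) hae
  have hA : ∃ i ≤ 1, a1 = p i := by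
    rcases ha1 with h | h
    · exact ⟨0, by omega, h⟩
    · exact ⟨1, by omega, h⟩
  obtain ⟨i, hi, rfl⟩ := hA
  have hbd : n1 ≤ k := by
    by_contra hn
    push Not at hn
    apply hcyc
    refine PO.cycle (p1.snoc hadj (fun h => hd _ h p2.right))
      (p2.rev.snoc haa (fun h => hd _ p1.left h)) ?_ ?_ (by omega) (by omega)
    · intro h; have := hinj _ (by omega) _ (by omega) h; omega
    · rintro x (hx | hx) (hx' | hx')
      · right; exact hx
      · right; exact hx
      · left; exact hx'
      · exact absurd hx' (hd x hx)
  obtain ⟨q, hq, hq0, hqn, -⟩ := p1.toPF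
  have := (hp.near hcyc hk n1 q i (m - 2) hq (by omega) (by omega) hq0 hqn).1
  have : k * n1 ≤ k * k := Nat.mul_le_mul_left _ hbd
  omega

end BPath

section Rank
variable {V : Type*} [Fintype V] {G : SimpleGraph V}

open Classical in
lemma elim_order (G : SimpleGraph V) (t : ℕ) (X : Finset V) :
    ∃ K : Finset V, K ⊆ X ∧ ∃ o : V → ℕ,
      (∀ v ∈ K, t + 1 ≤ {z ∈ (K : Set V) | G.Adj v z}.ncard) ∧
      (∀ v ∈ K, o v = 0) ∧
      (∀ v ∈ X, v ∉ K → 0 < o v ∧ (X.filter (fun w => G.Adj v w ∧ o w < o v)).card ≤ t) ∧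
      (∀ u ∈ X, ∀ w ∈ X, G.Adj u w → o u = o w → u ∈ K) := by
  induction X using Finset.strongInduction with
  | _ X ih =>
    by_cases hX : ∀ v ∈ X, t + 1 ≤ {z ∈ (X : Set V) | G.Adj v z}.ncard
    · exact ⟨X, subset_rfl, fun _ => 0, hX, fun _ _ => rfl, fun v h1 h2 => absurd h1 h2,
        fun u hu _ _ _ _ => hu⟩
    push Not at hX
    obtain ⟨v, hv, hdeg⟩ := hX
    obtain ⟨K, hK, o, h1, h2, h3, h4⟩ := ih _ (Finset.erase_ssubset hv)
    have hvK : v ∉ K := fun h => by simpa using hK h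
    have hbig : ∀ w, o w < 1 + Finset.univ.sup o := fun w => by
      have := Finset.le_sup (f := o) (Finset.mem_univ w)
      omega
    refine ⟨K, hK.trans (Finset.erase_subset _ _), Function.update o v (1 + Finset.univ.sup o),
      h1, ?_, ?_, ?_⟩
    · intro w hw
      rw [Function.update_of_ne (by rintro rfl; exact hvK hw)]
      exact h2 w hw
    · intro w hw hwK
      by_cases hwv : w = v
      · subst hwv
        refine ⟨by simp, ?_⟩
        have : ((X.filter (fun z => G.Adj w z ∧ Function.update o w (1 + Finset.univ.sup o) z <
            Function.update o w (1 + Finset.univ.sup o) w) : Finset V) : Set V) ⊆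
            {z ∈ (X : Set V) | G.Adj w z} := by
          intro z hz
          simp only [Finset.coe_filter, Set.mem_ofPred_eq] at hz
          exact ⟨hz.1, hz.2.1⟩
        have := Set.ncard_le_ncard this (Set.toFinite _)
        rw [Set.ncard_coe_finset] at this
        omega
      · have := h3 w (by simp [hwv, hw]) hwK
        rw [Function.update_of_ne hwv]
        refine ⟨this.1, (Finset.card_le_card ?_).trans this.2⟩
        intro z hz
        simp only [Finset.mem_filter] at hz ⊢
        by_cases hzv : z = v
        · subst hzv
          have := hbig w
          simp at hz
          omega
        · rw [Function.update_of_ne hzv] at hz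
          exact ⟨by simp [hzv, hz.1], hz.2⟩
    · intro a ha b hb hab ho
      by_cases hav : a = v
      · subst hav
        rw [Function.update_self, Function.update_of_ne hab.ne'] at ho
        have := hbig b
        omega
      · by_cases hbv : b = v
        · subst hbv
          rw [Function.update_self, Function.update_of_ne hav] at ho
          have := hbig a
          omega
        · rw [Function.update_of_ne hav, Function.update_of_ne hbv] at ho
          exact h4 a (by simp [ha, hav]) b (by simp [hb, hbv]) hab ho

/-- bound used in the rank argument -/
def bseq (t m : ℕ) : ℕ → ℕ
  | 0 => (2 * t + 1) + ((2 * t + 1) * (2 * t + 1) + t * t)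
  | i + 1 => bseq t m i + m * 2 ^ (bseq t m i)

open Classical in
lemma find_T (t m : ℕ) (ht : 1 ≤ t) (h2 : TwoConnected G)
    (hcyc : ¬ HasCycleGE G (2 * t + 2)) (he : t * (Fintype.card V - t) ≤ edgeCount G)
    (hn : bseq t m ((2 * t + 2) * (2 * t + 2) + 4) < Fintype.card V) :
    ∃ T : Finset V, T.card = t ∧ ∃ C : Finset V, m ≤ C.card ∧ ∀ c ∈ C, ∀ a ∈ T, G.Adj c a := by
  obtain ⟨K, -, o, h1, hK0, h3, h4⟩ := elim_order G t Finset.univ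
  have hKc : K.card < 2 * (t + 1) := core_bound h2 (by omega) (by
    rwa [show 2 * (t + 1) = 2 * t + 2 by ring]) K h1
  set out : V → Finset V := fun v => Finset.univ.filter (fun w => G.Adj v w ∧ o w < o v) with hout
  have hmo : ∀ v w, w ∈ out v ↔ G.Adj v w ∧ o w < o v := fun v w => by simp [hout]
  have hsub : G.edgeSet ⊆ (((K ×ˢ K).image (fun q => s(q.1, q.2)) ∪
      Kᶜ.biUnion (fun v => (out v).image (fun w => s(v, w))) : Finset (Sym2 V)) : Set (Sym2 V)) := by
    intro e he
    induction e using Sym2.ind with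
    | _ a b =>
      rw [mem_edgeSet] at he
      have hpos : ∀ {x y : V}, o x < o y → y ∉ K := fun h hy => by
        have := hK0 _ hy; omega
      rw [Finset.mem_coe, Finset.mem_union]
      rcases lt_trichotomy (o a) (o b) with h | h | h
      · right
        simp only [Finset.mem_biUnion, Finset.mem_compl, Finset.mem_image]
        exact ⟨b, hpos h, a, (hmo _ _).2 ⟨he.symm, h⟩, Sym2.eq_swap⟩
      · left
        simp only [Finset.mem_image, Finset.mem_product]
        exact ⟨(a, b), ⟨h4 a (by simp) b (by simp) he h, h4 b (by simp) a (by simp) he.symm h.symm⟩,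
          rfl⟩
      · right
        simp only [Finset.mem_biUnion, Finset.mem_compl, Finset.mem_image]
        exact ⟨a, hpos h, b, (hmo _ _).2 ⟨he, h⟩, rfl⟩
  have hcount : edgeCount G ≤ K.card * K.card + ∑ v ∈ Kᶜ, (out v).card := by
    have := Set.ncard_le_ncard hsub (Finset.finite_toSet _)
    rw [Set.ncard_coe_finset] at this
    refine this.trans ((Finset.card_union_le _ _).trans (Nat.add_le_add ?_ ?_))
    · exact Finset.card_image_le.trans (by rw [Finset.card_product])
    · exact Finset.card_biUnion_le.trans (Finset.sum_le_sum fun v _ => Finset.card_image_le)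
  have hle : ∀ v ∈ Kᶜ, (out v).card ≤ t := fun v hv => (h3 v (by simp) (by simpa using hv)).2
  set E := Kᶜ.filter (fun v => (out v).card < t) with hE
  have hsum : ∑ v ∈ Kᶜ, (out v).card + E.card ≤ t * Kᶜ.card := by
    rw [hE, Finset.card_filter, ← Finset.sum_add_distrib, mul_comm, ← smul_eq_mul]
    apply Finset.sum_le_card_nsmul
    intro v hv
    have := hle v hv
    split_ifs <;> omega
  have hEc : E.card ≤ (2 * t + 1) * (2 * t + 1) + t * t := by
    have e1 : K.card * K.card ≤ (2 * t + 1) * (2 * t + 1) :=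
      Nat.mul_le_mul (by omega) (by omega)
    have e2 : t * Kᶜ.card ≤ t * Fintype.card V := Nat.mul_le_mul_left _ (Finset.card_le_univ _)
    have e3 : t * Fintype.card V ≤ t * (Fintype.card V - t) + t * t := by
      rw [← Nat.mul_add]; exact Nat.mul_le_mul_left _ (by omega)
    omega
  by_contra hno
  push Not at hno
  let S : ℕ → Finset V := fun i => Nat.rec (motive := fun _ => Finset V) (K ∪ E)
    (fun _ s => s ∪ (Finset.univ : Finset V).filter (fun v : V => out v ⊆ s)) i
  have hS0 : S 0 = K ∪ E := rfl
  have hSs : ∀ i, S (i + 1) = S i ∪ (Finset.univ : Finset V).filter (fun v : V => out v ⊆ S i) := fun i => rfl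
  have hmono : ∀ i, K ∪ E ⊆ S i := by
    intro i
    induction i with
    | zero => exact subset_rfl
    | succ i ih => rw [hSs]; exact ih.trans Finset.subset_union_left
  have hb : ∀ i, (S i).card ≤ bseq t m i := by
    intro i
    induction i with
    | zero =>
      rw [hS0]
      refine (Finset.card_union_le _ _).trans ?_
      simp only [bseq]
      omega
    | succ i ih =>
      have hss : S (i + 1) ⊆ S i ∪ ((S i).powersetCard t).biUnion
          (fun T => Finset.univ.filter (fun v => ∀ a ∈ T, G.Adj v a)) := by
        rw [hSs]
        intro v hv
        rw [Finset.mem_union] at hv ⊢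
        rcases hv with hv | hv
        · exact Or.inl hv
        by_cases hvS : v ∈ S i
        · exact Or.inl hvS
        right
        simp only [Finset.mem_filter, Finset.mem_univ, true_and] at hv
        have hvKE : v ∉ K ∪ E := fun h => hvS (hmono i h)
        simp only [Finset.mem_union, not_or] at hvKE
        have hvK : v ∈ Kᶜ := by simpa using hvKE.1
        have hct : (out v).card = t := by
          have h5 := hvKE.2
          rw [hE, Finset.mem_filter] at h5
          have := hle v hvK
          by_contra hh
          exact h5 ⟨hvK, by omega⟩
        rw [Finset.mem_biUnion]
        refine ⟨out v, Finset.mem_powersetCard.2 ⟨hv, hct⟩, ?_⟩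
        simp only [Finset.mem_filter, Finset.mem_univ, true_and]
        intro a ha
        exact ((hmo _ _).1 ha).1
      refine (Finset.card_le_card hss).trans ((Finset.card_union_le _ _).trans ?_)
      have hc2 : (((S i).powersetCard t).biUnion
          (fun T => Finset.univ.filter (fun v => ∀ a ∈ T, G.Adj v a))).card ≤
          ((S i).powersetCard t).card * m := by
        apply Finset.card_biUnion_le_card_mul
        intro T hT
        rw [Finset.mem_powersetCard] at hT
        by_contra hh
        push Not at hh
        obtain ⟨c, hc, a, ha, hca⟩ := hno T hT.2 _ hh.le
        simp only [Finset.mem_filter, Finset.mem_univ, true_and] at hc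
        exact hca (hc a ha)
      have hc3 : ((S i).powersetCard t).card ≤ 2 ^ bseq t m i := by
        calc _ ≤ (S i).powerset.card :=
              Finset.card_le_card (fun T hT => Finset.mem_powerset.2 (Finset.mem_powersetCard.1 hT).1)
          _ = 2 ^ (S i).card := Finset.card_powerset _
          _ ≤ _ := Nat.pow_le_pow_right (by norm_num) ih
      have := Nat.mul_le_mul_right m hc3
      simp only [bseq]
      rw [mul_comm m]
      omega
  have hpath : ∀ i, ∀ v, v ∉ S i → ∃ q : ℕ → V, q 0 = v ∧
      ∀ j < i, G.Adj (q j) (q (j + 1)) ∧ o (q (j + 1)) < o (q j) := by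
    intro i
    induction i with
    | zero => intro v _; exact ⟨fun _ => v, rfl, fun j hj => by omega⟩
    | succ i ih =>
      intro v hv
      rw [hSs] at hv
      simp only [Finset.mem_union, not_or, Finset.mem_filter, Finset.mem_univ, true_and] at hv
      obtain ⟨w, hw, hwS⟩ := Finset.not_subset.1 hv.2
      obtain ⟨q, hq0, hq⟩ := ih w hwS
      rw [hmo] at hw
      refine ⟨fun j => Nat.casesOn j v q, rfl, fun j hj => ?_⟩
      cases j with
      | zero => simpa [hq0] using hw
      | succ j => exact hq j (by omega)
  obtain ⟨v, hv⟩ : ∃ v, v ∉ S ((2 * t + 2) * (2 * t + 2) + 4) := by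
    by_contra hh
    push Not at hh
    have h5 := hb ((2 * t + 2) * (2 * t + 2) + 4)
    have h6 : S ((2 * t + 2) * (2 * t + 2) + 4) = Finset.univ := by ext; simp [hh]
    rw [h6, Finset.card_univ] at h5
    omega
  obtain ⟨q, -, hq⟩ := hpath ((2 * t + 2) * (2 * t + 2) + 4) v hv
  have hdec : ∀ d i, 0 < d → i + d ≤ (2 * t + 2) * (2 * t + 2) + 4 → o (q (i + d)) < o (q i) := by
    intro d
    induction d with
    | zero => intro i h; omega
    | succ d ih =>
      intro i _ hid
      have h5 := (hq (i + d) (by omega)).2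
      rcases Nat.eq_zero_or_pos d with rfl | hd
      · exact h5
      · exact h5.trans (ih i hd (by omega))
  have hPF : PF G q ((2 * t + 2) * (2 * t + 2) + 4 + 1) := by
    refine ⟨fun i hi => (hq i (by omega)).1, fun i hi j hj hij => ?_⟩
    rcases lt_trichotomy i j with h | h | h
    · have := hdec (j - i) i (by omega) (by omega)
      rw [show i + (j - i) = j by omega, hij] at this
      omega
    · exact h
    · have := hdec (i - j) j (by omega) (by omega)
      rw [show j + (i - j) = i by omega, hij] at this
      omega
  have := hPF.bounded h2 hcyc (by omega)
  omega

end Rank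

section StepB
variable {V : Type*} {G : SimpleGraph V}

lemma PO.unsnoc {u v : V} {S : Set V} {n : ℕ} (h : PO G u v S (n + 1)) :
    ∃ z, PO G u z (S \ {v}) n ∧ G.Adj z v := by
  obtain ⟨p, hp, h0, hn, hS⟩ := h.toPF
  refine ⟨p n, ?_, hn ▸ hp.1 n (by omega)⟩
  have := hp.seg 0 n (by omega) (by omega)
  rw [h0, Nat.sub_zero] at this
  convert this using 1
  rw [hS, ← hn]
  ext x
  constructor
  · rintro ⟨⟨i, hi, rfl⟩, hx⟩
    refine ⟨i, by omega, ?_, rfl⟩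
    by_contra hh
    apply hx
    rw [show i = n + 1 by omega]; rfl
  · rintro ⟨i, -, hi, rfl⟩
    refine ⟨⟨i, by omega, rfl⟩, fun hx => ?_⟩
    have := hp.2 _ (by omega) _ (by omega) hx
    omega

open Classical in
lemma comb (C : Finset V) (Z : Finset V) (n : ℕ) : ∀ (U : Finset V), U.card = n + 1 →
    (∀ c ∈ C, ∀ a ∈ U, G.Adj c a) → Z.card + 2 * U.card ≤ C.card → ∀ a ∈ U, ∀ b ∈ U,
    (a = b → n = 0) →
    ∃ S, PO G a b S (2 * n) ∧ ∀ x ∈ S, x ∈ U ∨ (x ∈ C ∧ x ∉ Z) := by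
  induction n with
  | zero =>
    intro U hU _ _ a ha b hb _
    have : a = b := Finset.card_le_one.1 hU.le a ha b hb
    subst this
    exact ⟨_, PO.nil G a, by rintro x rfl; exact Or.inl ha⟩
  | succ n ih =>
    intro U hU hadj hc a ha b hb hab
    have hab' : a ≠ b := fun h => by have := hab h; omega
    have hUb : (U.erase b).card = n + 1 := by rw [Finset.card_erase_of_mem hb]; omega
    obtain ⟨b', hb', hab''⟩ : ∃ b' ∈ U.erase b, (a = b' → n = 0) := by
      rcases Nat.eq_zero_or_pos n with rfl | hn
      · exact ⟨a, by simp [hab', ha], fun _ => rfl⟩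
      · obtain ⟨b', h1, h2⟩ := Finset.exists_mem_ne (s := U.erase b) (by omega) a
        exact ⟨b', h1, fun h => absurd h.symm h2⟩
    obtain ⟨S, hS, hS'⟩ := ih (U.erase b) hUb (fun c hc a ha => hadj c hc a (Finset.mem_of_mem_erase ha))
      (by omega) a (by simp [hab', ha]) b' hb' hab''
    have hfin := hS.finite
    obtain ⟨c, hcC, hcZ⟩ : ∃ c ∈ C, c ∉ Z ∪ hfin.toFinset := by
      by_contra hh
      push Not at hh
      have h1 := (Finset.card_le_card hh).trans (Finset.card_union_le _ _)
      have h2 : hfin.toFinset.card = 2 * n + 1 := by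
        rw [← hS.ncard, Set.ncard_eq_toFinset_card _ hfin]
      omega
    simp only [Finset.mem_union, not_or, Set.Finite.mem_toFinset] at hcZ
    have hbS : b ∉ S := fun h => by
      rcases hS' b h with h | h
      · simp at h
      · exact (hadj b h.1 b hb).ne rfl
    have hcb := hadj c hcC b hb
    refine ⟨_, (hS.snoc (hadj c hcC b' (Finset.mem_of_mem_erase hb')).symm hcZ.2).snoc hcb ?_, ?_⟩
    · rintro (h | h)
      · exact hcb.ne h.symm
      · exact hbS h
    · rintro x (rfl | rfl | hx)
      · exact Or.inl hb
      · exact Or.inr ⟨hcC, hcZ.1⟩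
      · rcases hS' x hx with h | h
        · exact Or.inl (Finset.mem_of_mem_erase h)
        · exact Or.inr h

/-- The hypotheses of the structural step. -/
structure SB [Fintype V] (G : SimpleGraph V) (t : ℕ) (T C : Finset V) : Prop where
  ht : 2 ≤ t
  h2 : TwoConnected G
  hcyc : ¬ HasCycleGE G (2 * t + 2)
  hT : T.card = t
  hC : ∀ c ∈ C, ∀ a ∈ T, G.Adj c a
  hCc : (2 * t + 2) * (2 * t + 2) + 4 + 2 * t ≤ C.card

variable [Fintype V] {t : ℕ} {T C : Finset V}

lemma SB.notT (h : SB G t T C) {c : V} (hc : c ∈ C) : c ∉ T := fun h' => (h.hC c hc c h').ne rfl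

open Classical in
lemma SB.path (h : SB G t T C) {u v a b : V} {S : Set V} {n : ℕ} (p : PO G u v S n)
    (hS : ∀ x ∈ S, x ∉ T) (hn : 2 ≤ n) (ha : a ∈ T) (hb : b ∈ T) (hua : G.Adj u a)
    (hvb : G.Adj v b) : a = b := by
  by_contra hab
  have ht := h.ht
  have hT := h.hT
  have hfin := p.finite
  have hbd : n + 1 ≤ (2 * t + 2) * (2 * t + 2) + 4 := by
    obtain ⟨q, hq, -⟩ := p.toPF
    exact hq.bounded h.h2 h.hcyc (by omega)
  have hcard : hfin.toFinset.card = n + 1 := by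
    rw [← p.ncard, Set.ncard_eq_toFinset_card _ hfin]
  obtain ⟨S', p', hS'⟩ := comb (G := G) C hfin.toFinset (t - 1) T (by omega) h.hC
    (by have := h.hCc; omega) b hb a ha (fun hh => absurd hh.symm hab)
  have haS : a ∉ S := fun hh => hS a hh ha
  have hbS : b ∉ S := fun hh => hS b hh hb
  have q := p'.snoc hua.symm (fun hh => by
    rcases hS' u hh with h1 | h1
    · exact hS u p.left h1
    · exact h1.2 (by simpa using p.left))
  apply h.hcyc
  refine PO.cycle q (p.snoc hvb hbS) ?_ ?_ (by omega) (by omega)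
  · rintro rfl; exact hbS p.left
  · rintro x (rfl | hx) (hx' | hx')
    · exact Or.inr rfl
    · exact Or.inr rfl
    · exact Or.inl hx'
    · rcases hS' x hx with h1 | h1
      · exact absurd h1 (hS x hx')
      · exact absurd (by simpa using hx') h1.2

lemma SB.edge (h : SB G t T C) {u v : V} (hu : u ∉ T) (hv : v ∉ T) (huv : G.Adj u v) :
    ∃ a ∈ T, ∃ b ∈ T, a ≠ b ∧ G.Adj u a ∧ G.Adj v b := by
  have ht := h.ht
  have hT := h.hT
  obtain ⟨b, hb⟩ : T.Nonempty := by rw [← Finset.card_pos]; omega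
  obtain ⟨w, hw, e, he, S, n, p, -, hSD, hSB⟩ := connPath h.h2 {u, v} (T : Set V) v u b
    (by simp) huv.ne hb (by rintro rfl; exact hv hb)
  have hA : ∃ x ∈ ({u, v} : Set V), x ≠ w := by
    by_cases huw : u = w
    · exact ⟨v, by simp, by rw [← huw]; exact huv.ne'⟩
    · exact ⟨u, by simp, huw⟩
  obtain ⟨a1, a2, e1, e2, S1, S2, ⟨⟨n1, p1⟩, ha1, he1, hA1, hB1⟩, ⟨⟨n2, p2⟩, ha2, he2, hA2, hB2⟩,
    hd, -, -⟩ := fan h.h2 _ _ w e S ⟨⟨n, p⟩, hw, he, hSD, hSB⟩ hA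
      (by
        obtain ⟨x, hx, hx'⟩ := Finset.exists_mem_ne (s := T) (by omega) e
        exact ⟨x, hx, hx'⟩)
  have hae : a1 ≠ a2 := fun hh => hd _ p1.left (hh ▸ p2.left)
  have hee : e1 ≠ e2 := fun hh => hd _ p1.right (hh ▸ p2.right)
  have hadj : G.Adj a1 a2 := by
    rcases ha1 with rfl | h1 <;> rcases ha2 with rfl | h2
    · exact absurd rfl hae
    · rw [h2]; exact huv
    · rw [h1]; exact huv.symm
    · exact absurd (h1.trans h2.symm) hae
  have hW : ∀ x ∈ ({u, v} : Set V), x ∉ T := by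
    rintro x (rfl | rfl) <;> assumption
  have hn1 : n1 ≠ 0 := by
    rintro rfl
    obtain ⟨w, -, hw, -⟩ := p1
    exact hW a1 ha1 (Walk.eq_of_length_eq_zero hw ▸ he1)
  have hn2 : n2 ≠ 0 := by
    rintro rfl
    obtain ⟨w, -, hw, -⟩ := p2
    exact hW a2 ha2 (Walk.eq_of_length_eq_zero hw ▸ he2)
  obtain ⟨m1, rfl⟩ := Nat.exists_eq_succ_of_ne_zero hn1
  obtain ⟨m2, rfl⟩ := Nat.exists_eq_succ_of_ne_zero hn2
  obtain ⟨z1, q1, hz1⟩ := p1.unsnoc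
  obtain ⟨z2, q2, hz2⟩ := p2.unsnoc
  have r := (q1.rev.snoc hadj (fun hh => hd _ hh.1 p2.left)).append q2 (by
    rintro x (hx | hx) hx'
    · exact hx
    · exact absurd hx'.1 (hd _ hx.1))
  have hlen : m1 = 0 ∧ m2 = 0 := by
    by_contra hh
    refine hee (h.path r ?_ (by omega) he1 he2 hz1 hz2)
    rintro x ((rfl | hx) | hx) hxT
    · exact hW _ ha2 hxT
    · exact hx.2 (hB1 _ hx.1 hxT)
    · exact hx.2 (hB2 _ hx.1 hxT)
  obtain ⟨rfl, rfl⟩ := hlen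
  have hz1' : a1 = z1 := by
    obtain ⟨w, -, hw, -⟩ := q1
    exact Walk.eq_of_length_eq_zero hw
  have hz2' : a2 = z2 := by
    obtain ⟨w, -, hw, -⟩ := q2
    exact Walk.eq_of_length_eq_zero hw
  subst hz1' hz2'
  rcases ha1 with rfl | h1 <;> rcases ha2 with rfl | h2
  · exact absurd rfl hae
  · rw [h2] at hz2; exact ⟨e1, he1, e2, he2, hee, hz1, hz2⟩
  · rw [h1] at hz1; exact ⟨e2, he2, e1, he1, hee.symm, hz2, hz1⟩
  · exact absurd (h1.trans h2.symm) hae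

lemma SB.p3 (h : SB G t T C) {x y z a b : V} (hx : x ∉ T) (hy : y ∉ T) (hz : z ∉ T)
    (hxy : G.Adj x y) (hyz : G.Adj y z) (hxz : x ≠ z) (ha : a ∈ T) (hb : b ∈ T) (hxa : G.Adj x a)
    (hzb : G.Adj z b) : a = b := by
  refine h.path ((PO.edge hxy).snoc hyz ?_) ?_ le_rfl ha hb hxa hzb
  · rintro (hh | hh)
    · exact hxz hh.symm
    · exact hyz.ne hh.symm
  · rintro w (rfl | rfl | rfl) <;> assumption

/-- The end of a path on three vertices outside `T` has only one neighbour outside `T`. -/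
lemma SB.deg1 (h : SB G t T C) {x y z w : V} (hx : x ∉ T) (hy : y ∉ T) (hz : z ∉ T) (hw : w ∉ T)
    (hxy : G.Adj x y) (hyz : G.Adj y z) (hxz : x ≠ z) (hxw : G.Adj x w) : w = y := by
  by_contra hwy
  obtain ⟨b, hb, b', hb', hbb, hxb, hyb⟩ := h.edge hx hy hxy
  obtain ⟨c, hc, d, hd, hcd, hyc, hzd⟩ := h.edge hy hz hyz
  obtain ⟨e, he, f, hf, hef, hwe, hxf⟩ := h.edge hw hx hxw.symm
  have e1 := h.p3 hx hy hz hxy hyz hxz hb hd hxb hzd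
  have e2 := h.p3 hw hx hy hxw.symm hxy hwy he hb' hwe hyb
  subst e1 e2
  by_cases hwz : w = z
  · subst hwz
    exact hbb (h.p3 hx hy hw hxy hyz hxz hb he hxb hwe)
  · refine hbb (h.path (((PO.edge hxw.symm).snoc hxy ?_).snoc hyz ?_) ?_ (by norm_num) he hd hwe hzd).symm
    · rintro (hh | hh)
      · exact hwy hh.symm
      · exact hxy.ne hh.symm
    · rintro (hh | hh | hh)
      · exact hyz.ne hh.symm
      · exact hwz hh.symm
      · exact hxz hh.symm
    · rintro q (rfl | rfl | rfl | rfl) <;> assumption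

lemma SB.nonfull (h : SB G t T C) {x y z : V} (hx : x ∉ T) (hy : y ∉ T) (hz : z ∉ T)
    (hxy : G.Adj x y) (hyz : G.Adj y z) (hxz : x ≠ z) : ¬ ∀ a ∈ T, G.Adj x a := by
  intro hfull
  obtain ⟨c, hc, d, hd, hcd, hyc, hzd⟩ := h.edge hy hz hyz
  exact hcd (h.p3 hx hy hz hxy hyz hxz hc hd (hfull c hc) hzd)

open Classical in
lemma SB.big (h : SB G t T C) {x y p q a d : V} (hx : x ∉ T) (hy : y ∉ T) (hp : p ∉ T) (hq : q ∉ T)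
    (hxp : x ≠ p) (hxq : x ≠ q) (hyp : y ≠ p) (hyq : y ≠ q)
    (hxy : G.Adj y x) (hpq : G.Adj p q) (ha : a ∈ T) (hd : d ∈ T) (had : a ≠ d)
    (hay : G.Adj a y) (hfull : ∀ a ∈ T, G.Adj x a) (hdp : G.Adj d p) (hqa : G.Adj q a) : False := by
  have ht := h.ht
  have hT := h.hT
  have hc1 : (T.erase a).card = t - 1 := by rw [Finset.card_erase_of_mem ha, hT]
  obtain ⟨c, hc, hcd⟩ : ∃ c ∈ T.erase a, (c = d → t - 2 = 0) := by
    rcases Nat.lt_or_ge 2 t with h3 | h3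
    · obtain ⟨b', h1, h2⟩ := Finset.exists_mem_ne (s := T.erase a) (by omega) d
      exact ⟨b', h1, fun h => absurd h h2⟩
    · exact ⟨d, by simp [had.symm, hd], fun _ => by omega⟩
  have hZ : ({x, y, p, q} : Finset V).card ≤ 4 := Finset.card_le_four
  obtain ⟨S, r, hS⟩ := comb (G := G) C {x, y, p, q} (t - 2) (T.erase a) (by omega)
    (fun c hc b hb => h.hC c hc b (Finset.mem_of_mem_erase hb))
    (by have := h.hCc; omega) c hc d (by simp [had.symm, hd]) hcd
  have haS : a ∉ S := fun hh => by
    rcases hS a hh with h1 | h1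
    · simp at h1
    · exact h.notT h1.1 ha
  have hZS : ∀ z ∈ ({x, y, p, q} : Finset V), z ∉ S := fun z hz hh => by
    rcases hS z hh with h1 | h1
    · have := Finset.mem_of_mem_erase h1
      simp only [Finset.mem_insert, Finset.mem_singleton] at hz
      rcases hz with rfl | rfl | rfl | rfl <;> contradiction
    · exact h1.2 hz
  have hxS := hZS x (by simp)
  have hyS := hZS y (by simp)
  have hpS := hZS p (by simp)
  have hqS := hZS q (by simp)
  have hxa : x ≠ a := by rintro rfl; exact hx ha
  have hpa : p ≠ a := by rintro rfl; exact hp ha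
  have hqa' : q ≠ a := by rintro rfl; exact hq ha
  have hya : y ≠ a := by rintro rfl; exact hy ha
  have r1 := (r.snoc hdp hpS).snoc hpq (by
    rintro (hh | hh)
    · exact hpq.ne hh.symm
    · exact hqS hh)
  have r2 := (((PO.edge hay).snoc hxy (by
    rintro (hh | hh)
    · exact hxa hh
    · exact hxy.ne hh.symm)).snoc (hfull c (Finset.mem_of_mem_erase hc)) (by
    rintro (hh | hh | hh)
    · exact hxS (hh ▸ r.left)
    · exact haS (hh ▸ r.left)
    · exact hyS (hh ▸ r.left)))
  apply h.hcyc
  refine PO.cycle (r2.append r1 ?_) (PO.edge hqa) ?_ ?_ (by omega) (by omega)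
  · intro z hz1 hz2
    rcases hz1 with h1 | h1 | h1 | h1
    · exact h1
    · rw [h1] at hz2
      rcases hz2 with h2 | h2 | h2
      · exact absurd h2 hxq
      · exact absurd h2 hxp
      · exact absurd h2 hxS
    · rw [h1] at hz2
      rcases hz2 with h2 | h2 | h2
      · exact absurd h2.symm hqa'
      · exact absurd h2.symm hpa
      · exact absurd h2 haS
    · rw [h1] at hz2
      rcases hz2 with h2 | h2 | h2
      · exact absurd h2 hyq
      · exact absurd h2 hyp
      · exact absurd h2 hyS
  · exact hqa'.symm
  · rintro z _ (rfl | rfl)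
    · right; rfl
    · left; rfl

lemma SB.disj (h : SB G t T C) {x1 y1 x2 y2 : V} (hx1 : x1 ∉ T) (hy1 : y1 ∉ T) (hx2 : x2 ∉ T)
    (hy2 : y2 ∉ T) (h1 : G.Adj x1 y1) (h2 : G.Adj x2 y2) (f1 : ∀ a ∈ T, G.Adj x1 a)
    (f2 : ∀ a ∈ T, G.Adj x2 a) (hxx : x1 ≠ x2) (hxy : x1 ≠ y2) (hyx : y1 ≠ x2) (hyy : y1 ≠ y2) :
    False := by
  obtain ⟨-, -, a, ha, -, -, hya⟩ := h.edge hx1 hy1 h1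
  obtain ⟨-, -, b, hb, -, -, hyb⟩ := h.edge hx2 hy2 h2
  by_cases hab : a = b
  · subst hab
    obtain ⟨d, hd, hda⟩ := Finset.exists_mem_ne (s := T) (by have := h.ht; have := h.hT; omega) a
    exact h.big hx1 hy1 hx2 hy2 hxx hxy hyx hyy h1.symm h2 ha hd hda.symm hya.symm f1 (f2 d hd).symm hyb
  · exact h.big hx1 hy1 hy2 hx2 hxy hxx hyy hyx h1.symm h2.symm ha hb hab hya.symm f1 hyb.symm
      (f2 a ha)

end StepB

section Count
variable {V : Type*} {G : SimpleGraph V} [Fintype V] {t : ℕ} {T C : Finset V}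

open Classical in
lemma SB.twins (h : SB G t T C) : ∃ D : Finset V, C.card ≤ D.card + 2 ∧
    ∀ c ∈ D, ∀ x, G.Adj c x ↔ x ∈ T := by
  refine ⟨C.filter (fun c => ∀ x ∉ T, ¬ G.Adj c x), ?_, ?_⟩
  · have := Finset.card_filter_add_card_filter_not (s := C) (fun c => ∀ x ∉ T, ¬ G.Adj c x)
    have h3 : (C.filter (fun c => ¬ ∀ x ∉ T, ¬ G.Adj c x)).card ≤ 2 := by
      by_contra hh
      push Not at hh
      obtain ⟨x1, hx1, x2, hx2, x3, hx3, h12, h13, h23⟩ := Finset.two_lt_card.1 hh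
      simp only [Finset.mem_filter] at hx1 hx2 hx3
      obtain ⟨c1, y1, hy1, a1⟩ := hx1
      obtain ⟨c2, y2, hy2, a2⟩ := hx2
      obtain ⟨c3, y3, hy3, a3⟩ := hx3
      have key : ∀ {x x' y y' : V}, x ∈ C → x' ∈ C → y ∉ T → y' ∉ T → G.Adj x y → G.Adj x' y' →
          x ≠ x' → y = x' := by
        intro x x' y y' hx hx' hy hy' ha ha' hxx
        by_contra hyx
        have hT := h.notT hx
        have hT' := h.notT hx'
        by_cases hyy : y = y'
        · subst hyy
          exact h.nonfull hT hy hT' ha ha'.symm hxx (h.hC x hx)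
        by_cases hxy : x = y'
        · subst hxy
          exact h.nonfull hT' hT hy ha' ha (Ne.symm hyx) (h.hC x' hx')
        exact h.disj hT hy hT' hy' ha ha' (h.hC x hx) (h.hC x' hx') hxx hxy hyx hyy
      exact h23 ((key c1 c2 hy1 hy2 a1 a2 h12).symm.trans (key c1 c3 hy1 hy3 a1 a3 h13))
    omega
  · intro c hc x
    simp only [Finset.mem_filter] at hc
    refine ⟨fun hcx => ?_, fun hx => h.hC c hc.1 x hx⟩
    by_contra hx
    exact hc.2 x hx hcx

open Classical in
lemma SB.edges (h : SB G t T C) :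
    edgeCount G ≤ edgesWithin G T + t * (Fintype.card V - t) + 1 := by
  set nf := Tᶜ.filter (fun x => ¬ ∀ a ∈ T, G.Adj x a) with hnf
  let nb : V → V := fun x => if hx : ∃ y, y ∉ T ∧ G.Adj x y then hx.choose else x
  have hnb : ∀ x y, y ∉ T → G.Adj x y → nb x ∉ T ∧ G.Adj x (nb x) := by
    intro x y hy hxy
    have hx : ∃ y, y ∉ T ∧ G.Adj x y := ⟨y, hy, hxy⟩
    simp only [nb, hx, dif_pos]
    exact hx.choose_spec
  set bad := {e ∈ G.edgeSet | (∀ x ∈ e, x ∉ T) ∧ e ∉ nf.image (fun x => s(x, nb x))} with hbad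
  have hcov : G.edgeSet ⊆ {e ∈ G.edgeSet | ∀ x ∈ e, x ∈ T} ∪
      ((Tᶜ.biUnion (fun w => (T.filter (fun a => G.Adj w a)).image (fun a => s(w, a))) ∪
        nf.image (fun x => s(x, nb x)) : Finset (Sym2 V)) : Set (Sym2 V)) ∪ bad := by
    intro e he
    induction e using Sym2.ind with
    | _ a b =>
      rw [mem_edgeSet] at he
      have hcr : ∀ {a b : V}, a ∉ T → b ∈ T → G.Adj a b → s(a, b) ∈
        (Tᶜ.biUnion (fun w => (T.filter (fun a => G.Adj w a)).image (fun a => s(w, a)))) := by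
        intro a b ha hb hab
        simp only [Finset.mem_biUnion, Finset.mem_compl, Finset.mem_image, Finset.mem_filter]
        exact ⟨a, ha, b, ⟨hb, hab⟩, rfl⟩
      by_cases ha : a ∈ T <;> by_cases hb : b ∈ T
      · left; left
        refine ⟨he, ?_⟩
        intro x hx
        rcases Sym2.mem_iff.1 hx with rfl | rfl <;> assumption
      · left; right
        rw [Finset.mem_coe, Finset.mem_union]
        left
        rw [Sym2.eq_swap]
        exact hcr hb ha he.symm
      · left; right
        rw [Finset.mem_coe, Finset.mem_union]
        left
        exact hcr ha hb he
      · by_cases hh : s(a, b) ∈ nf.image (fun x => s(x, nb x))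
        · left; right
          rw [Finset.mem_coe, Finset.mem_union]
          exact Or.inr hh
        · right
          refine ⟨he, ?_, hh⟩
          intro x hx
          rcases Sym2.mem_iff.1 hx with rfl | rfl <;> assumption
  -- a bad edge is isolated and has full ends
  have hbadE : ∀ x y, s(x, y) ∈ bad → x ∉ T ∧ y ∉ T ∧ G.Adj x y ∧ (∀ a ∈ T, G.Adj x a) ∧
      (∀ z ∉ T, G.Adj x z → z = y) := by
    rintro x y ⟨he, hT, hni⟩
    have hx : x ∉ T := hT x (by simp)
    have hy : y ∉ T := hT y (by simp)
    rw [mem_edgeSet] at he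
    -- the only way out: a nonfull end of degree one
    have key : ∀ u v, s(u, v) = s(x, y) → u ∉ T → v ∉ T → G.Adj u v → (∀ z ∉ T, G.Adj u z → z = v) →
        ∀ a ∈ T, G.Adj u a := by
      intro u v huv hu hv ha hz
      by_contra hf
      apply hni
      rw [Finset.mem_image]
      refine ⟨u, by simp only [hnf, Finset.mem_filter, Finset.mem_compl]; exact ⟨hu, hf⟩, ?_⟩
      obtain ⟨h1, h2⟩ := hnb u v hv ha
      rw [hz _ h1 h2, huv]
    have d1 : ∀ z ∉ T, G.Adj x z → z = y := by
      intro z hz hxz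
      by_contra hzy
      -- y - x - z
      have hd : ∀ w ∉ T, G.Adj y w → w = x := fun w hw hyw =>
        h.deg1 hy hx hz hw he.symm hxz (Ne.symm hzy) hyw
      exact h.nonfull hy hx hz he.symm hxz (Ne.symm hzy) (key y x Sym2.eq_swap hy hx he.symm hd)
    exact ⟨hx, hy, he, key x y rfl hx hy he d1, d1⟩
  have hbad1 : bad.ncard ≤ 1 := by
    rw [Set.ncard_le_one_iff (Set.toFinite _)]
    intro e1 e2 he1 he2
    induction e1 using Sym2.ind with
    | _ x y =>
    induction e2 using Sym2.ind with
    | _ z w =>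
      obtain ⟨hx, hy, hxy, fx, dx⟩ := hbadE x y he1
      obtain ⟨-, -, -, -, dy⟩ := hbadE y x (by rwa [Sym2.eq_swap])
      obtain ⟨hz, hw, hzw, fz, dz⟩ := hbadE z w he2
      by_contra hne
      have n1 : x ≠ z := by
        rintro rfl; apply hne; rw [dx w hw hzw]
      have n2 : x ≠ w := by
        rintro rfl; apply hne; rw [dx z hz hzw.symm]; exact Sym2.eq_swap
      have n3 : y ≠ z := by
        rintro rfl; apply hne; rw [dy w hw hzw]; exact Sym2.eq_swap
      have n4 : y ≠ w := by
        rintro rfl; apply hne; rw [dy z hz hzw.symm]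
      exact h.disj hx hy hz hw hxy hzw fx fz n1 n2 n3 n4
  have hc1 : (Tᶜ.biUnion (fun w => (T.filter (fun a => G.Adj w a)).image (fun a => s(w, a)))).card ≤
      ∑ w ∈ Tᶜ, (T.filter (fun a => G.Adj w a)).card :=
    Finset.card_biUnion_le.trans (Finset.sum_le_sum fun v _ => Finset.card_image_le)
  have hc2 : ∑ w ∈ Tᶜ, (T.filter (fun a => G.Adj w a)).card + nf.card ≤ t * (Fintype.card V - t) := by
    have hcc : Tᶜ.card = Fintype.card V - t := by rw [Finset.card_compl, h.hT]
    rw [hnf, Finset.card_filter, ← Finset.sum_add_distrib, mul_comm, ← hcc, ← smul_eq_mul]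
    apply Finset.sum_le_card_nsmul
    intro v hv
    have h1 : (T.filter (fun a => G.Adj v a)).card ≤ t := h.hT ▸ Finset.card_filter_le _ _
    by_cases hf : ∀ a ∈ T, G.Adj v a
    · rw [if_neg (not_not.2 hf)]; exact h1
    · rw [if_pos hf]
      have h2 : (T.filter (fun a => G.Adj v a)).card < T.card := by
        apply Finset.card_lt_card
        rw [Finset.filter_ssubset]
        push Not at hf
        exact hf
      have := h.hT
      omega
  have hfin := Set.ncard_le_ncard hcov (Set.toFinite _)
  have u1 := Set.ncard_union_le ({e ∈ G.edgeSet | ∀ x ∈ e, x ∈ T} ∪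
      ((Tᶜ.biUnion (fun w => (T.filter (fun a => G.Adj w a)).image (fun a => s(w, a))) ∪
        nf.image (fun x => s(x, nb x)) : Finset (Sym2 V)) : Set (Sym2 V))) bad
  have u2 := Set.ncard_union_le {e ∈ G.edgeSet | ∀ x ∈ e, x ∈ T}
      ((Tᶜ.biUnion (fun w => (T.filter (fun a => G.Adj w a)).image (fun a => s(w, a))) ∪
        nf.image (fun x => s(x, nb x)) : Finset (Sym2 V)) : Set (Sym2 V))
  rw [Set.ncard_coe_finset] at u2
  have u3 := Finset.card_union_le (Tᶜ.biUnion (fun w => (T.filter (fun a => G.Adj w a)).image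
    (fun a => s(w, a)))) (nf.image (fun x => s(x, nb x)))
  have u4 : (nf.image (fun x => s(x, nb x))).card ≤ nf.card := Finset.card_image_le
  have e1 : edgeCount G = G.edgeSet.ncard := rfl
  have e2 : edgesWithin G (T : Set V) = {e ∈ G.edgeSet | ∀ x ∈ e, x ∈ T}.ncard := by
    simp [edgesWithin]
  omega

end Count

section Transport
variable {V W α : Type*} {G : SimpleGraph V} {H : SimpleGraph W}

lemma cyc_fun {k : ℕ} (h : HasCycleGE G k) :
    ∃ (L : ℕ) (f : ℕ → V), k ≤ L ∧ 3 ≤ L ∧ PF G f L ∧ G.Adj (f (L - 1)) (f 0) := by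
  obtain ⟨v, w, hw, hk⟩ := h
  refine ⟨w.length, w.getVert, hk, hw.three_le_length,
    ⟨fun i hi => w.adj_getVert_succ (by omega), fun i hi j hj hij => ?_⟩, ?_⟩
  · exact hw.getVert_injOn' (by simp; omega) (by simp; omega) hij
  · have h3 := hw.three_le_length
    have := w.adj_getVert_succ (i := w.length - 1) (by omega)
    rw [show w.length - 1 + 1 = w.length by omega] at this
    simpa using this

lemma PF.mapOn {f : ℕ → V} {L : ℕ} (h : PF G f L) (φ : V → W)
    (hadj : ∀ a b, G.Adj a b → H.Adj (φ a) (φ b))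
    (hinj : ∀ i < L, ∀ j < L, φ (f i) = φ (f j) → f i = f j) : PF H (fun i => φ (f i)) L :=
  ⟨fun i hi => hadj _ _ (h.1 i hi), fun i hi j hj hij => h.2 i hi j hj (hinj i hi j hj hij)⟩

lemma HasCycleGE.transport {k : ℕ} (h : HasCycleGE G k) (φ : V → W)
    (hadj : ∀ a b, G.Adj a b → H.Adj (φ a) (φ b)) (hinj : Function.Injective φ) :
    HasCycleGE H k := by
  obtain ⟨L, f, hk, h3, hf, hc⟩ := cyc_fun h
  exact (hf.mapOn φ hadj (fun i _ j _ hij => hinj hij)).closed_cycle h3 hk (hadj _ _ hc)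

/-- at most `t` vertices of a cycle have all their neighbours in a `t`-set -/
lemma cyc_count {L t : ℕ} {f : ℕ → V} (h3 : 3 ≤ L) (hf : PF G f L) (hc : G.Adj (f (L - 1)) (f 0))
    (T : Finset V) (hT : T.card = t) (I : Finset ℕ) (hI : ∀ i ∈ I, i < L)
    (hN : ∀ i ∈ I, ∀ x, G.Adj (f i) x → x ∈ T) : I.card ≤ t := by
  classical
  rw [← hT]
  apply Finset.card_le_card_of_injOn (fun i => if i + 1 < L then f (i + 1) else f 0)
  · intro i hi
    have h1 := hI i hi
    simp only
    split_ifs with h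
    · exact hN i hi _ (hf.1 i h)
    · have : i = L - 1 := by omega
      subst this
      exact hN _ hi _ hc
  · intro i hi j hj hij
    have h1 := hI i hi
    have h2 := hI j hj
    simp only at hij
    split_ifs at hij with h h' h'
    · have := hf.2 _ h _ h' hij; omega
    · have := hf.2 _ h _ (by omega) hij; omega
    · have := hf.2 _ (by omega) _ h' hij; omega
    · omega

lemma indep_cycle {t : ℕ} (T : Finset V) (hT : T.card = t)
    (hN : ∀ x y, G.Adj x y → x ∉ T → y ∈ T) : ¬ HasCycleGE G (2 * t + 2) := by
  classical
  intro h
  obtain ⟨L, f, hk, h3, hf, hc⟩ := cyc_fun h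
  have h1 := cyc_count h3 hf hc T hT ((Finset.range L).filter (fun i => f i ∉ T))
    (fun i hi => by simpa using (Finset.mem_filter.1 hi).1)
    (fun i hi x hx => hN _ _ hx (by simpa using (Finset.mem_filter.1 hi).2))
  have h2 : ((Finset.range L).filter (fun i => f i ∈ T)).card ≤ T.card := by
    apply Finset.card_le_card_of_injOn f
    · intro i hi
      simpa using (Finset.mem_filter.1 hi).2
    · intro i hi j hj hij
      have := Finset.mem_filter.1 hi
      have := Finset.mem_filter.1 hj
      exact hf.2 i (by simp_all) j (by simp_all) hij
  have := Finset.card_filter_add_card_filter_not (s := Finset.range L) (fun i => f i ∈ T)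
  rw [Finset.card_range] at this
  omega

/-- `x` and `y` are connected avoiding `z` -/
def RA (G : SimpleGraph V) (z x y : V) : Prop := ∃ w : G.Walk x y, z ∉ w.support

lemma RA.symm {z x y : V} (h : RA G z x y) : RA G z y x := by
  obtain ⟨w, hw⟩ := h; exact ⟨w.reverse, by simpa using hw⟩

lemma RA.trans {z x y u : V} (h : RA G z x y) (h' : RA G z y u) : RA G z x u := by
  obtain ⟨w, hw⟩ := h
  obtain ⟨w', hw'⟩ := h'
  exact ⟨w.append w', by simp [Walk.mem_support_append_iff, hw, hw']⟩

lemma RA.adj {z x y : V} (h : G.Adj x y) (hx : x ≠ z) (hy : y ≠ z) : RA G z x y :=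
  ⟨Walk.cons h Walk.nil, by simp [hx.symm, hy.symm]⟩

lemma RA.refl {z x : V} (hx : x ≠ z) : RA G z x x := ⟨Walk.nil, by simp [hx.symm]⟩

lemma twoConn_of [Fintype V] (h3 : 3 ≤ Fintype.card V)
    (h : ∀ z x y, x ≠ z → y ≠ z → RA G z x y) : TwoConnected G := by
  classical
  have hex : ∀ x y : V, ∃ z, z ≠ x ∧ z ≠ y := by
    intro x y
    by_contra hh
    push Not at hh
    have : (Finset.univ : Finset V) ⊆ {x, y} := by
      intro z _
      by_cases hz : z = x
      · simp [hz]
      · simp [hh z hz]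
    have := (Finset.card_le_card this).trans Finset.card_le_two
    rw [Finset.card_univ] at this
    omega
  have hne : Nonempty V := Fintype.card_pos_iff.1 (by omega)
  refine ⟨h3, ?_, ?_⟩
  · refine { preconnected := fun x y => ?_, nonempty := hne }
    obtain ⟨z, hz, hz'⟩ := hex x y
    obtain ⟨w, -⟩ := h z x y hz.symm hz'.symm
    exact ⟨w⟩
  · intro v
    refine { preconnected := ?_, nonempty := ?_ }
    · rintro ⟨x, hx⟩ ⟨y, hy⟩
      obtain ⟨w, hw⟩ := h v x y (by simpa using hx) (by simpa using hy)
      exact ⟨w.induce _ (fun u hu => by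
        simp only [Set.mem_compl_iff, Set.mem_singleton_iff]
        rintro rfl; exact hw hu)⟩
    · obtain ⟨z, hz, -⟩ := hex v v
      exact ⟨⟨z, by simpa using hz⟩⟩

lemma RA.map {z x y : V} (h : RA G z x y) (φ : V → W) (hadj : ∀ a b, G.Adj a b → H.Adj (φ a) (φ b))
    (hinj : Function.Injective φ) : RA H (φ z) (φ x) (φ y) := by
  obtain ⟨w, hw⟩ := h
  let F : G →g H := ⟨φ, fun {a b} h => hadj a b h⟩
  refine ⟨(w.map F : H.Walk (F x) (F y)), ?_⟩
  have e : (w.map F).support = w.support.map F := Walk.support_map _ _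
  rw [e, List.mem_map]
  rintro ⟨a, ha, ha'⟩
  exact hw (hinj ha' ▸ ha)

lemma exMax_bdd (n : ℕ) (P : SimpleGraph (Fin n) → Prop) :
    BddAbove {m | ∃ G : SimpleGraph (Fin n), P G ∧ edgeCount G = m} := by
  refine ⟨Nat.card (Sym2 (Fin n)), ?_⟩
  rintro m ⟨G, -, rfl⟩
  exact Set.ncard_le_card _

lemma le_exMax {n : ℕ} {P : SimpleGraph (Fin n) → Prop} {G : SimpleGraph (Fin n)} (h : P G) :
    edgeCount G ≤ exMax n P := le_csSup (exMax_bdd n P) ⟨G, h, rfl⟩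

lemma exMax_mem {n : ℕ} {P : SimpleGraph (Fin n) → Prop} (h : ∃ G, P G) :
    ∃ G, P G ∧ edgeCount G = exMax n P := by
  obtain ⟨G, hG⟩ := h
  exact Nat.sSup_mem (s := {m | ∃ G : SimpleGraph (Fin n), P G ∧ edgeCount G = m})
    ⟨_, G, hG, rfl⟩ (exMax_bdd n P)

lemma edgeCount_transport (φ : V → W) (hadj : ∀ a b, G.Adj a b → H.Adj (φ a) (φ b))
    (hinj : Function.Injective φ) [Finite W] : edgeCount G ≤ edgeCount H := by
  unfold edgeCount
  rw [← Set.ncard_image_of_injective _ (Sym2.map.injective hinj)]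
  apply Set.ncard_le_ncard _ (Set.toFinite _)
  rintro _ ⟨e, he, rfl⟩
  induction e using Sym2.ind with
  | _ a b => exact hadj a b he

/-- The property of the main theorem. -/
def MP [Fintype V] (t : ℕ) (F : SimpleGraph α) (G : SimpleGraph V) : Prop :=
  TwoConnected G ∧ ¬ HasCycleGE G (2 * t + 2) ∧ ¬ ContainsCopy F G

lemma MP.le_exMax [Fintype V] {t n : ℕ} {F : SimpleGraph α} (h : MP t F G)
    (hn : Fintype.card V = n) : edgeCount G ≤ exMax n (fun G => MP t F G) := by
  have e : V ≃ Fin n := Fintype.equivFinOfCardEq hn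
  have h1 : ∀ a b, G.Adj a b → (G.comap e.symm).Adj (e a) (e b) := by
    intro a b h; simpa using h
  have h2 : ∀ a b, (G.comap e.symm).Adj a b → G.Adj (e.symm a) (e.symm b) := fun a b h => h
  refine (edgeCount_transport e h1 e.injective).trans (_root_.le_exMax ?_)
  refine ⟨twoConn_of (by simpa [hn] using h.1.1) ?_, ?_, ?_⟩
  · intro z x y hx hy
    have := RA.map (two_conn_walk h.1 (e.symm z) (e.symm x) (e.symm y) (by simpa using hx)
      (by simpa using hy)) e h1 e.injective
    simpa using this
  · intro hc
    exact h.2.1 (hc.transport e.symm h2 e.symm.injective)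
  · rintro ⟨f, hf, hf'⟩
    exact h.2.2 ⟨fun a => e.symm (f a), e.symm.injective.comp hf, fun a b hab => hf' hab⟩

end Transport

section Final
variable {V W α : Type*} {G : SimpleGraph V}

lemma coverFree_bot [Fintype α] {t : ℕ} (F : SimpleGraph α) (hp : PGE F (t + 1)) :
    CoverFree F (⊥ : SimpleGraph (Fin t)) := by
  classical
  rintro S hS ⟨f, hf, hf'⟩
  have hSc : S.ncard ≤ t := by
    have := Nat.card_le_card_of_injective f hf
    rwa [Nat.card_coe_set_eq, Nat.card_fin] at this
  have := (hp (fun a => decide (a ∈ S)) (by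
    intro a b hab
    by_cases ha : a ∈ S <;> by_cases hb : b ∈ S
    · exact absurd (hf' (a := ⟨a, ha⟩) (b := ⟨b, hb⟩) hab) (by simp)
    · simp [ha, hb]
    · simp [ha, hb]
    · exact absurd hab (hS a b ha hb))).1
  simp at this
  omega

lemma within_le [Fintype V] [Fintype α] {t : ℕ} {F : SimpleGraph α} (hF : ¬ ContainsCopy F G)
    (T D : Finset V) (hT : T.card = t) (hD : ∀ c ∈ D, ∀ a ∈ T, G.Adj c a)
    (hDc : Fintype.card α ≤ D.card) : edgesWithin G T ≤ exMax t (CoverFree F) := by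
  classical
  let e : T ≃ Fin t := Fintype.equivFinOfCardEq (by simpa using hT)
  let i : Fin t → V := fun a => (e.symm a : V)
  have hi : Function.Injective i := Subtype.val_injective.comp e.symm.injective
  have hiT : ∀ a, i a ∈ T := fun a => (e.symm a).2
  have h1 : edgesWithin G T ≤ edgeCount (G.comap i) := by
    unfold edgesWithin edgeCount
    rw [← Set.ncard_image_of_injective _ (Sym2.map.injective hi)]
    apply Set.ncard_le_ncard _ (Set.toFinite _)
    rintro x ⟨hx, hxT⟩
    induction x using Sym2.ind with
    | _ a b =>
      have ha : a ∈ T := hxT a (by simp)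
      have hb : b ∈ T := hxT b (by simp)
      exact ⟨s(e ⟨a, ha⟩, e ⟨b, hb⟩), by simpa [i] using hx, by simp [i]⟩
  refine h1.trans (le_exMax ?_)
  rintro S hS ⟨f, hf, hf'⟩
  apply hF
  obtain ⟨g⟩ : Nonempty (α ↪ D) := Function.Embedding.nonempty_of_card_le (by simpa using hDc)
  have hgT : ∀ a, (g a : V) ∉ T := fun a ha => (hD _ (g a).2 _ ha).ne rfl
  refine ⟨fun a => if ha : a ∈ S then i (f ⟨a, ha⟩) else g a, ?_, ?_⟩
  · intro a b hab
    simp only at hab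
    split_ifs at hab with ha hb hb
    · simpa using hf (hi hab)
    · exact absurd (hab ▸ hiT _) (hgT b)
    · exact absurd (hab ▸ hiT _) (hgT a)
    · exact g.injective (Subtype.ext hab)
  · intro a b hab
    simp only
    split_ifs with ha hb hb
    · exact hf' (a := ⟨a, ha⟩) (b := ⟨b, hb⟩) hab
    · exact (hD _ (g b).2 _ (hiT _)).symm
    · exact hD _ (g a).2 _ (hiT _)
    · exact absurd hab (hS a b ha hb)

lemma join_ll (t b : ℕ) (H : SimpleGraph (Fin t)) (x y : Fin t) :
    (joinIndep t b H).Adj (Sum.inl x) (Sum.inl y) ↔ H.Adj x y := by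
  simp only [joinIndep, SimpleGraph.fromRel_adj]
  constructor
  · rintro ⟨-, (h | ⟨u, v, h1, h2, h3⟩) | (h | ⟨u, v, h1, h2, h3⟩)⟩
    · simp at h
    · cases h1; cases h2; exact h3
    · simp at h
    · cases h1; cases h2; exact h3.symm
  · intro h
    exact ⟨by simpa using h.ne, Or.inl (Or.inr ⟨x, y, rfl, rfl, h⟩)⟩

lemma join_lr (t b : ℕ) (H : SimpleGraph (Fin t)) (x : Fin t) (y : Fin b) :
    (joinIndep t b H).Adj (Sum.inl x) (Sum.inr y) := by
  simp [joinIndep]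

lemma join_rr (t b : ℕ) (H : SimpleGraph (Fin t)) (x y : Fin b) :
    ¬ (joinIndep t b H).Adj (Sum.inr x) (Sum.inr y) := by
  simp [joinIndep]

lemma join_MP {t b : ℕ} (ht : 2 ≤ t) (hb : 2 ≤ b) {F : SimpleGraph α} (H : SimpleGraph (Fin t))
    (hH : CoverFree F H) : MP t F (joinIndep t b H) := by
  classical
  refine ⟨twoConn_of (by simp; omega) ?_, ?_, ?_⟩
  · have hl : ∀ z : Fin t ⊕ Fin b, ∃ a : Fin t, Sum.inl a ≠ z := by
      intro z
      by_cases h : Sum.inl ⟨0, by omega⟩ = z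
      · exact ⟨⟨1, by omega⟩, by rw [← h]; simp⟩
      · exact ⟨_, h⟩
    have hr : ∀ z : Fin t ⊕ Fin b, ∃ a : Fin b, Sum.inr a ≠ z := by
      intro z
      by_cases h : Sum.inr ⟨0, by omega⟩ = z
      · exact ⟨⟨1, by omega⟩, by rw [← h]; simp⟩
      · exact ⟨_, h⟩
    rintro z (x | x) (y | y) hx hy
    · obtain ⟨a, ha⟩ := hr z
      exact (RA.adj (join_lr t b H x a) hx ha).trans (RA.adj (join_lr t b H y a) hy ha).symm
    · exact RA.adj (join_lr t b H x y) hx hy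
    · exact (RA.adj (join_lr t b H y x) hy hx).symm
    · obtain ⟨a, ha⟩ := hl z
      exact (RA.adj (join_lr t b H a x) ha hx).symm.trans (RA.adj (join_lr t b H a y) ha hy)
  · apply indep_cycle (Finset.univ.image Sum.inl)
    · rw [Finset.card_image_of_injective _ Sum.inl_injective]; simp
    · rintro (x | x) (y | y) hxy hx
      · simp
      · simp at hx
      · simp
      · exact absurd hxy (join_rr t b H x y)
  · rintro ⟨f, hf, hf'⟩
    have hS : IsVertexCovering F {a | (f a).isLeft} := by
      intro a c ha hc hac
      have := hf' hac
      simp only [Set.mem_ofPred_eq, Bool.not_eq_true, Sum.isLeft_eq_false, Sum.isRight_iff] at ha hc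
      obtain ⟨x, hx⟩ := ha
      obtain ⟨y, hy⟩ := hc
      rw [hx, hy] at this
      exact join_rr t b H x y this
    apply hH _ hS
    have hg : ∀ a : {a | (f a).isLeft}, ∃ u, f a = Sum.inl u := fun a => Sum.isLeft_iff.1 a.2
    choose g hg using hg
    refine ⟨g, ?_, ?_⟩
    · intro a c hac
      apply Subtype.ext
      apply hf
      rw [hg, hg, hac]
    · intro a c hac
      have := hf' (show F.Adj a c from hac)
      rw [hg, hg, join_ll] at this
      exact this

lemma join_edges (t b : ℕ) (H : SimpleGraph (Fin t)) :
    edgeCount H + t * b ≤ edgeCount (joinIndep t b H) := by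
  classical
  have h1 : (Sym2.map (Sum.inl : Fin t → Fin t ⊕ Fin b) '' H.edgeSet).ncard = edgeCount H :=
    Set.ncard_image_of_injective _ (Sym2.map.injective Sum.inl_injective)
  have h2 : (Set.range (fun q : Fin t × Fin b => (s(Sum.inl q.1, Sum.inr q.2) : Sym2 (Fin t ⊕ Fin b)))).ncard
      = t * b := by
    rw [← Set.image_univ, Set.ncard_image_of_injective]
    · simp [Set.ncard_univ]
    · rintro ⟨a, c⟩ ⟨a', c'⟩ h
      simpa using h
  rw [← h1, ← h2, ← Set.ncard_union_eq]
  · apply Set.ncard_le_ncard _ (Set.toFinite _)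
    rintro e (⟨e, he, rfl⟩ | ⟨q, rfl⟩)
    · induction e using Sym2.ind with
      | _ x y => exact (join_ll t b H x y).2 he
    · exact join_lr t b H _ _
  · rw [Set.disjoint_left]
    rintro e ⟨e, he, rfl⟩ ⟨q, hq⟩
    induction e using Sym2.ind with
    | _ x y => simp at hq

/-- Add a new vertex joined exactly to `T`. -/
def addTwin (G : SimpleGraph V) (T : Finset V) : SimpleGraph (Option V) where
  Adj x y := match x, y with
    | some a, some b => G.Adj a b
    | none, some b => b ∈ T
    | some a, none => a ∈ T
    | none, none => False
  symm := ⟨by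
    rintro (_ | a) (_ | b) h
    · exact h
    · exact h
    · exact h
    · exact G.adj_symm h⟩
  loopless := ⟨by
    rintro (_ | a) h
    · exact h
    · exact G.loopless.irrefl a h⟩

lemma addTwin_edges [Fintype V] (G : SimpleGraph V) (T : Finset V) :
    edgeCount G + T.card ≤ edgeCount (addTwin G T) := by
  classical
  have h1 : (Sym2.map (some : V → Option V) '' G.edgeSet).ncard = edgeCount G :=
    Set.ncard_image_of_injective _ (Sym2.map.injective (Option.some_injective _))
  have h2 : ((fun a : V => (s(none, some a) : Sym2 (Option V))) '' (T : Set V)).ncard = T.card := by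
    rw [Set.ncard_image_of_injective, Set.ncard_coe_finset]
    intro a b h
    simpa using h
  rw [← h1, ← h2, ← Set.ncard_union_eq]
  · apply Set.ncard_le_ncard _ (Set.toFinite _)
    rintro e (⟨e, he, rfl⟩ | ⟨q, hq, rfl⟩)
    · induction e using Sym2.ind with
      | _ x y => exact he
    · exact hq
  · rw [Set.disjoint_left]
    rintro e ⟨e, he, rfl⟩ ⟨q, -, hq⟩
    induction e using Sym2.ind with
    | _ x y => simp at hq

lemma addTwin_MP [Fintype V] [Fintype α] {t : ℕ} (ht : 2 ≤ t) {F : SimpleGraph α} (h : MP t F G)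
    (T D : Finset V) (hT : T.card = t) (hD : ∀ c ∈ D, ∀ x, G.Adj c x ↔ x ∈ T)
    (hDt : t < D.card) (hDα : Fintype.card α < D.card) : MP t F (addTwin G T) := by
  classical
  let φ : V → Option V → V := fun d x => x.getD d
  have hφ : ∀ d ∈ D, ∀ a b, (addTwin G T).Adj a b → G.Adj (φ d a) (φ d b) := by
    rintro d hd (_ | a) (_ | b) hab
    · exact absurd hab id
    · exact (hD d hd b).2 hab
    · exact ((hD d hd a).2 hab).symm
    · exact hab
  have hinj : ∀ d, ∀ x y, x ≠ some d → y ≠ some d → φ d x = φ d y → x = y := by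
    rintro d (_ | a) (_ | b) hx hy hxy
    · rfl
    · simp only [φ, Option.getD] at hxy; exact absurd (hxy ▸ rfl) hy
    · simp only [φ, Option.getD] at hxy; exact absurd (hxy ▸ rfl) hx
    · simp only [φ, Option.getD] at hxy; rw [hxy]
  have hs : ∀ a b, G.Adj a b → (addTwin G T).Adj (some a) (some b) := fun a b hab => hab
  refine ⟨twoConn_of (by have := h.1.1; simp; omega) ?_, ?_, ?_⟩
  · have hss : ∀ z, ∀ x y : V, some x ≠ z → some y ≠ z → RA (addTwin G T) z (some x) (some y) := by
      rintro (_ | z) x y hx hy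
      · obtain ⟨w⟩ := h.1.2.1.preconnected x y
        let Fh : G →g addTwin G T := ⟨some, fun {a b} h => hs a b h⟩
        refine ⟨(w.map Fh : (addTwin G T).Walk (Fh x) (Fh y)), ?_⟩
        have e : (w.map Fh).support = w.support.map Fh := Walk.support_map _ _
        rw [e, List.mem_map]
        rintro ⟨a, -, ha⟩
        exact absurd ha (by simp [Fh])
      · exact RA.map (two_conn_walk h.1 z x y (by simpa using hx) (by simpa using hy)) some hs
          (Option.some_injective _)
    have hns : ∀ z, ∀ y : V, none ≠ z → some y ≠ z → RA (addTwin G T) z none (some y) := by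
      intro z y hx hy
      obtain ⟨a, ha, haz⟩ : ∃ a ∈ T, some a ≠ z := by
        cases z with
        | none => exact absurd rfl hx
        | some z =>
          obtain ⟨a, ha, h'⟩ := Finset.exists_mem_ne (s := T) (by omega) z
          exact ⟨a, ha, by simpa using h'⟩
      exact (RA.adj (show (addTwin G T).Adj none (some a) from ha) hx haz).trans (hss z a y haz hy)
    rintro z (_ | x) (_ | y) hx hy
    · exact RA.refl hx
    · exact hns z y hx hy
    · exact (hns z x hy hx).symm
    · exact hss z x y hx hy
  · intro hc
    obtain ⟨L, f, hk, h3, hf, hc⟩ := cyc_fun hc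
    -- an unused twin
    obtain ⟨d, hd, hdf⟩ : ∃ d ∈ D, ∀ i < L, f i ≠ some d := by
      by_contra hh
      push Not at hh
      choose! j hj hj' using hh
      have h4 := cyc_count h3 hf hc (T.image some)
        (by rw [Finset.card_image_of_injective _ (Option.some_injective _), hT]) (D.image j)
        (by
          intro i hi
          obtain ⟨d, hd, rfl⟩ := Finset.mem_image.1 hi
          exact hj d hd)
        (by
          intro i hi x hx
          obtain ⟨d, hd, rfl⟩ := Finset.mem_image.1 hi
          rw [hj' d hd] at hx
          cases x with
          | none => 
            have hdT : d ∈ T := hx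
            exact absurd ((hD d hd d).2 hdT) (G.loopless.irrefl d)
          | some x => exact Finset.mem_image_of_mem _ ((hD d hd x).1 hx))
      rw [Finset.card_image_of_injOn] at h4
      · omega
      · intro a ha b hb hab
        have h5 := hj' a ha
        rw [hab, hj' b hb] at h5
        exact (Option.some_injective _ h5).symm
    exact h.2.1 ((hf.mapOn (φ d) (hφ d hd) (fun i hi j hj hij =>
      hinj d _ _ (hdf i hi) (hdf j hj) hij)).closed_cycle h3 hk (hφ d hd _ _ hc))
  · rintro ⟨f, hf, hf'⟩
    obtain ⟨d, hd, hdf⟩ : ∃ d ∈ D, ∀ i, f i ≠ some d := by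
      by_contra hh
      push Not at hh
      have h1 : D.image some ⊆ Finset.univ.image f := by
        intro x hx
        obtain ⟨d, hd, rfl⟩ := Finset.mem_image.1 hx
        obtain ⟨i, hi⟩ := hh d hd
        rw [← hi]
        exact Finset.mem_image_of_mem _ (Finset.mem_univ _)
      have h2 := (Finset.card_le_card h1).trans Finset.card_image_le
      rw [Finset.card_image_of_injective _ (Option.some_injective _), Finset.card_univ] at h2
      omega
    exact h.2.2 ⟨fun a => φ d (f a), fun a b hab => hf (hinj d _ _ (hdf a) (hdf b) hab),
      fun a b hab => hφ d hd _ _ (hf' hab)⟩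

theorem main_aux [Fintype α] (t : ℕ) (ht : 2 ≤ t) (F : SimpleGraph α) (hpF : PGE F (t + 1)) :
    ∃ ℓ ≤ 1, ∃ N : ℕ, ∀ n : ℕ, N ≤ n →
      exMax n (fun G => MP t F G) = exMax t (CoverFree F) + t * (n - t) + ℓ := by
  obtain ⟨m, hm⟩ : ∃ m, m = (2 * t + 2) * (2 * t + 2) + 4 + 2 * t + Fintype.card α + 10 := ⟨_, rfl⟩
  obtain ⟨N0, hN0⟩ : ∃ N0, N0 = bseq t m ((2 * t + 2) * (2 * t + 2) + 4) + t + 3 := ⟨_, rfl⟩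
  obtain ⟨H, hH, hHe⟩ := exMax_mem ⟨_, coverFree_bot F hpF⟩
  have hlow : ∀ n, N0 ≤ n → (∃ G : SimpleGraph (Fin n), MP t F G) ∧
      exMax t (CoverFree F) + t * (n - t) ≤ exMax n (fun G => MP t F G) := by
    intro n hn
    have hJ : MP t F (joinIndep t (n - t) H) := join_MP ht (by omega) H hH
    have hle := hJ.le_exMax (n := n) (by simp; omega)
    have hpos : exMax t (CoverFree F) + t * (n - t) ≤ exMax n (fun G => MP t F G) := by
      have := join_edges t (n - t) H
      omega
    refine ⟨?_, hpos⟩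
    by_contra hh
    push Not at hh
    have h0 : exMax n (fun G => MP t F G) = 0 := by
      unfold exMax
      rw [show {m | ∃ G : SimpleGraph (Fin n), MP t F G ∧ edgeCount G = m} = ∅ by
        ext m; simp [hh]]
      simp
    have : 0 < t * (n - t) := Nat.mul_pos (by omega) (by omega)
    omega
  have hstep : ∀ n, N0 ≤ n →
      exMax n (fun G => MP t F G) ≤ exMax t (CoverFree F) + t * (n - t) + 1 ∧
      exMax n (fun G => MP t F G) + t ≤ exMax (n + 1) (fun G => MP t F G) := by
    intro n hn
    obtain ⟨hex, hlo⟩ := hlow n hn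
    obtain ⟨G, hG, hGe⟩ := exMax_mem (P := fun G => MP t F G) hex
    obtain ⟨T, hT, C, hC, hCT⟩ := find_T t m (by omega) hG.1 hG.2.1
      (by rw [Fintype.card_fin]; omega) (by rw [Fintype.card_fin]; omega)
    have hSB : SB G t T C := ⟨ht, hG.1, hG.2.1, hT, hCT, by omega⟩
    have he := hSB.edges
    rw [Fintype.card_fin] at he
    have hw := within_le hG.2.2 T C hT hCT (by omega)
    obtain ⟨D, hDC, hD⟩ := hSB.twins
    refine ⟨by omega, ?_⟩
    have hA := addTwin_MP ht hG T D hT hD (by omega) (by omega)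
    have h1 := hA.le_exMax (n := n + 1) (by simp)
    have h2 := addTwin_edges G T
    omega
  by_cases hex : ∃ n1, N0 ≤ n1 ∧
      exMax t (CoverFree F) + t * (n1 - t) + 1 ≤ exMax n1 (fun G => MP t F G)
  · obtain ⟨n1, hn1, h1⟩ := hex
    refine ⟨1, le_rfl, n1, fun n hn => ?_⟩
    have key : exMax t (CoverFree F) + t * (n - t) + 1 ≤ exMax n (fun G => MP t F G) := by
      induction n, hn using Nat.le_induction with
      | base => exact h1
      | succ n hn ih =>
        have h2 := (hstep n (by omega)).2
        have h3 : t * (n + 1 - t) = t * (n - t) + t := by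
          rw [show n + 1 - t = n - t + 1 by omega]; ring
        omega
    have := (hstep n (by omega)).1
    omega
  · push Not at hex
    refine ⟨0, by omega, N0, fun n hn => ?_⟩
    have h1 := hex n hn
    have h2 := (hlow n hn).2
    omega

end Final

/-- Dou–Hu–Peng, Theorem 4 (even case): for even `k ≥ 6`, `t = (k-2)/2` and `F`
with `p(F) ≥ t+1`, there is `ℓ ∈ {0,1}` such that for all sufficiently large `n`,
`ex_{2-conn}(n, {𝓒_{≥k}, F}) = ex(t, 𝓗) + t(n - t) + ℓ`. -/
theorem stmt1 {α : Type*} [Fintype α] (k : ℕ) (hk : 6 ≤ k) (hkeven : Even k)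
    (F : SimpleGraph α) (hpF : PGE F ((k - 2) / 2 + 1)) :
    ∃ ℓ ≤ 1, ∃ N : ℕ, ∀ n : ℕ, N ≤ n →
      exMax n (fun G => TwoConnected G ∧ ¬ HasCycleGE G k ∧ ¬ ContainsCopy F G)
        = exMax ((k - 2) / 2) (CoverFree F)
          + ((k - 2) / 2) * (n - (k - 2) / 2) + ℓ := by
  obtain ⟨j, rfl⟩ := hkeven
  obtain ⟨t, rfl⟩ : ∃ t, j = t + 1 := ⟨j - 1, by omega⟩
  have e1 : (t + 1 + (t + 1) - 2) / 2 = t := by omega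
  have e2 : t + 1 + (t + 1) = 2 * t + 2 := by omega
  rw [e1] at hpF ⊢
  rw [e2]
  exact main_aux t (by omega) F hpF
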